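/- arXiv:2203.14798 — 8 statements merged into one kernel-verified Lean document; each statement's English description precedes it below -/
import Mathlib

section
/- Let T be a minimum spanning tree of the complete weighted graph on (V, w), and let 𝒯 be a collection of pairwise edge-disjoint subtrees of T. Then TSP(w) ≤ 2·MST(w) − (1/2)·∑_{T' ∈ 𝒯} adv(T'). -/
open scoped Classical

variable {V : Type*}

/-- `w` is a metric on `V`: symmetric, zero on the diagonal, positive on pairs of distinct
points, and satisfying the triangle inequality. -/
structure IsMetric (w : V → V → ℝ) : Prop where
  symm : ∀ x y, w x y = w y x
  self : ∀ x, w x x = 0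
  pos : ∀ x y, x ≠ y → 0 < w x y
  triangle : ∀ x y z, w x z ≤ w x y + w y z

/-- The weight of an unordered pair of vertices (for symmetric `w` this is just `w`). -/
noncomputable def sym2Weight (w : V → V → ℝ) : Sym2 V → ℝ :=
  Sym2.lift ⟨fun a b => (w a b + w b a) / 2, fun a b => by ring⟩

/-- The total weight of a set of unordered pairs of vertices. -/
noncomputable def setWeight (w : V → V → ℝ) (S : Set (Sym2 V)) : ℝ :=
  ∑ᶠ e ∈ S, sym2Weight w e

/-- `MST(w)`: the minimum total weight of a spanning tree of the complete graph on `V`. -/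
noncomputable def MSTcost (V : Type*) [Fintype V] (w : V → V → ℝ) : ℝ :=
  sInf { x | ∃ T : SimpleGraph V, T.IsTree ∧ x = setWeight w T.edgeSet }

/-- The cost of the tour visiting the points of `V` in the cyclic order given by `f`. -/
noncomputable def tourCost (V : Type*) [Fintype V] (w : V → V → ℝ)
    (f : Fin (Fintype.card V) → V) : ℝ :=
  ∑ i : Fin (Fintype.card V),
    w (f i) (f ⟨((i : ℕ) + 1) % Fintype.card V, Nat.mod_lt _ i.pos⟩)

/-- `TSP(w)`: the minimum cost over all cyclic orderings of the points of `V`. -/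
noncomputable def TSPcost (V : Type*) [Fintype V] (w : V → V → ℝ) : ℝ :=
  sInf { x | ∃ f : Fin (Fintype.card V) ≃ V, x = tourCost V w ⇑f }

/-- The pair `f` is covered by the pair `e`: `f` lies on a path in `T` between the two
endpoints of `e` (in a tree, this path is unique). -/
def covers (T : SimpleGraph V) (e f : Sym2 V) : Prop :=
  ∃ (u v : V) (p : T.Walk u v), e = s(u, v) ∧ p.IsPath ∧ f ∈ p.edges

/-- `cov(E')`: the set of edges of `T` covered by at least one pair in `E'`. -/
def cov (T : SimpleGraph V) (E' : Set (Sym2 V)) : Set (Sym2 V) :=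
  { f | f ∈ T.edgeSet ∧ ∃ e ∈ E', covers T e f }

/-- A subtree of the tree `T` is a connected subgraph of `T`. -/
def IsSubtree (T : SimpleGraph V) (T' : T.Subgraph) : Prop :=
  T'.Connected

/-- `cov(E', T') = cov(E') ∩ E(T')`. -/
def covOn (T : SimpleGraph V) (E' : Set (Sym2 V)) (T' : T.Subgraph) : Set (Sym2 V) :=
  cov T E' ∩ T'.edgeSet

/-- The cover advantage of `E'` on `T'`: `w(cov(E', T')) − w(E')`. -/
noncomputable def advOf (w : V → V → ℝ) (T : SimpleGraph V)
    (E' : Set (Sym2 V)) (T' : T.Subgraph) : ℝ :=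
  setWeight w (covOn T E' T') - setWeight w E'

/-- `adv(T')`: the optimal cover advantage of `T'`, i.e. the maximum of `adv(E', T')`
over all sets `E'` of pairs each having at least one endpoint in `V(T')`. -/
noncomputable def adv (w : V → V → ℝ) (T : SimpleGraph V) (T' : T.Subgraph) : ℝ :=
  sSup { x | ∃ E' : Set (Sym2 V),
    (∀ e ∈ E', ∃ u ∈ T'.verts, u ∈ e) ∧ x = advOf w T E' T' }

/-- A vertex of `T'` is special iff its degree in `T'` is not `2`. -/
def IsSpecial (T : SimpleGraph V) (T' : T.Subgraph) (v : V) : Prop :=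
  v ∈ T'.verts ∧ (T'.neighborSet v).ncard ≠ 2

/-- `adv*(T')`: the optimal special cover advantage of `T'`, i.e. the maximum of
`adv(E', T')` over all sets `E'` of pairs each having at least one endpoint that is a
special vertex of `T'`. -/
noncomputable def advStar (w : V → V → ℝ) (T : SimpleGraph V) (T' : T.Subgraph) : ℝ :=
  sSup { x | ∃ E' : Set (Sym2 V),
    (∀ e ∈ E', ∃ u, IsSpecial T T' u ∧ u ∈ e) ∧ x = advOf w T E' T' }


/-! ### Boundaries of multisets of edges -/

/-- The boundary modulo two of an unordered pair; it vanishes on diagonal pairs. -/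
noncomputable def edgeBoundary : Sym2 V → V → ZMod 2 :=
  Sym2.lift ⟨fun a b => Pi.single a 1 + Pi.single b 1, fun _ _ => add_comm _ _⟩

@[simp]
theorem edgeBoundary_mk (a b : V) :
    edgeBoundary s(a, b) = Pi.single a 1 + Pi.single b 1 := rfl

theorem add_self_eq_zero_of_zmod_two (f : V → ZMod 2) : f + f = 0 :=
  funext fun _ => CharTwo.add_self_eq_zero _

theorem edgeBoundary_eq_zero_of_notMem {e : Sym2 V} {v : V} (h : v ∉ e) :
    edgeBoundary e v = 0 := by
  induction e with
  | _ a b =>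
    simp only [Sym2.mem_iff, not_or] at h
    simp [h.1, h.2]

theorem sum_edgeBoundary_walk {G : SimpleGraph V} {u v : V} (p : G.Walk u v) :
    (p.edges.map edgeBoundary).sum = Pi.single u 1 + Pi.single v 1 := by
  induction p with
  | nil => simp [add_self_eq_zero_of_zmod_two]
  | @cons a b c h p ih =>
    have := add_self_eq_zero_of_zmod_two (Pi.single b 1 : V → ZMod 2)
    rw [SimpleGraph.Walk.edges_cons, List.map_cons, List.sum_cons, ih, edgeBoundary_mk]
    linear_combination this

/-! ### Closed walks in even multigraphs -/

/-- A connected multigraph all of whose degrees are even has a closed walk that visits every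
vertex and uses every edge at most as often as its multiplicity. -/
theorem exists_closed_walk_of_even {T : SimpleGraph V} (hT : T.Connected)
    (M : Multiset (Sym2 V)) (hloop : ∀ e ∈ M, ¬ e.IsDiag)
    (heven : (M.map edgeBoundary).sum = 0) (hTM : ∀ e ∈ T.edgeSet, e ∈ M) :
    ∃ (u : V) (p : (⊤ : SimpleGraph V).Walk u u),
      (p.edges : Multiset (Sym2 V)) ≤ M ∧ ∀ v, v ∈ p.support := by
  obtain ⟨u, v, p, hp, hmax⟩ : ∃ (u v : V) (p : (⊤ : SimpleGraph V).Walk u v),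
      (p.edges : Multiset (Sym2 V)) ≤ M ∧
      ∀ (u' v' : V) (q : (⊤ : SimpleGraph V).Walk u' v'),
        (q.edges : Multiset (Sym2 V)) ≤ M → q.length ≤ p.length := by
    let P : ℕ → Prop := fun n => ∃ (u v : V) (p : (⊤ : SimpleGraph V).Walk u v),
      (p.edges : Multiset (Sym2 V)) ≤ M ∧ p.length = n
    have hbound : ∀ n, P n → n ≤ M.card := by
      rintro n ⟨u, v, p, hp, rfl⟩
      simpa using Multiset.card_le_card hp
    have h0 : P 0 := ⟨hT.nonempty.some, _, SimpleGraph.Walk.nil, by simp, rfl⟩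
    obtain ⟨u, v, p, hp, hn⟩ := Nat.findGreatest_spec (Nat.zero_le M.card) h0
    refine ⟨u, v, p, hp, fun u' v' q hq => ?_⟩
    rw [hn]
    exact Nat.le_findGreatest (hbound _ ⟨u', v', q, hq, rfl⟩) ⟨u', v', q, hq, rfl⟩
  have hext : ∀ {a b : V} (q : (⊤ : SimpleGraph V).Walk a b) (R : Multiset (Sym2 V)) (c : V),
      M = (q.edges : Multiset (Sym2 V)) + R → q.length = p.length → s(c, a) ∉ R := by
    intro a b q R c hM hlen hc
    have hadj : (⊤ : SimpleGraph V).Adj c a := by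
      simpa using hloop s(c, a) (hM ▸ Multiset.mem_add.2 (Or.inr hc))
    have := hmax _ _ (SimpleGraph.Walk.cons hadj q) (by
      obtain ⟨R', rfl⟩ := Multiset.exists_cons_of_mem hc
      rw [hM, SimpleGraph.Walk.edges_cons, ← Multiset.cons_coe, Multiset.add_cons]
      exact Multiset.cons_le_cons _ (Multiset.le_add_right _ _))
    simp at this
    omega
  obtain ⟨R, hR⟩ := Multiset.le_iff_exists_add.1 hp
  obtain rfl : u = v := by
    by_contra huv
    rw [hR, Multiset.map_add, Multiset.sum_add, Multiset.map_coe, Multiset.sum_coe,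
      sum_edgeBoundary_walk] at heven
    have hu := congrFun heven u
    have hzero : (R.map edgeBoundary).sum u = 0 := by
      change Pi.evalAddMonoidHom (fun _ : V => ZMod 2) u (R.map edgeBoundary).sum = 0
      rw [map_multiset_sum, Multiset.map_map]
      refine Multiset.sum_eq_zero fun x hx => ?_
      obtain ⟨e, he, rfl⟩ := Multiset.mem_map.1 hx
      refine edgeBoundary_eq_zero_of_notMem fun hue => ?_
      obtain ⟨c, rfl⟩ := Sym2.mem_iff_exists.1 hue
      exact hext p R c hR rfl (Sym2.eq_swap ▸ he)
    simp [hzero, huv] at hu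
  refine ⟨u, p, hp, fun v => ?_⟩
  by_contra hv
  obtain ⟨d, -, hd1, hd2⟩ := (hT.preconnected u v).some.exists_boundary_dart
    {x | x ∈ p.support} p.start_mem_support hv
  have hdM : s(d.snd, d.fst) ∈ M := hTM _ d.adj.symm
  have hdR : s(d.snd, d.fst) ∈ R := by
    rw [hR, Multiset.mem_add] at hdM
    exact hdM.resolve_left fun h => hd2 (p.fst_mem_support_of_mem_edges (Multiset.mem_coe.1 h))
  have hperm := (p.rotate_edges d.fst hd1).perm
  refine hext (p.rotate d.fst hd1) R d.snd ?_ ?_ hdR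
  · rw [hR, Multiset.coe_eq_coe.2 hperm]
  · simp

/-! ### Shortcutting closed walks -/

/-- The length of the path visiting the points of a list in order. -/
def listCost (w : V → V → ℝ) : List V → ℝ
  | [] => 0
  | [_] => 0
  | a :: b :: l => w a b + listCost w (b :: l)

theorem listCost_append_singleton (w : V → V → ℝ) (a b : V) (l : List V) :
    listCost w (l ++ [a, b]) = listCost w (l ++ [a]) + w a b := by
  induction l with
  | nil => simp [listCost]
  | cons x l ih =>
    cases l with
    | nil => simp [listCost]
    | cons y l =>
      simp only [List.cons_append, listCost] at ih ⊢
      rw [ih]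
      ring

theorem listCost_cons_le (w : V → V → ℝ) (hw : IsMetric w) (a x b : V) (l : List V) :
    listCost w (a :: (l ++ [b])) ≤ w a x + listCost w (x :: (l ++ [b])) := by
  cases l with
  | nil => simpa [listCost] using hw.triangle a x b
  | cons y l =>
    simp only [List.cons_append, listCost]
    linarith [hw.triangle a x y]

theorem listCost_le_of_sublist (w : V → V → ℝ) (hw : IsMetric w) (b : V) {l l' : List V}
    (h : l.Sublist l') (a : V) :
    listCost w (a :: (l ++ [b])) ≤ listCost w (a :: (l' ++ [b])) := by
  induction h generalizing a with
  | slnil => rfl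
  | cons x _ ih =>
    refine (listCost_cons_le w hw a x b _).trans ?_
    simp only [List.cons_append, listCost]
    linarith [ih x]
  | cons_cons x _ ih =>
    simp only [List.cons_append, listCost]
    linarith [ih x]

theorem listCost_eq_sum_range (w : V → V → ℝ) (d a : V) (l : List V) :
    listCost w (a :: l) =
      ∑ i ∈ Finset.range l.length, w ((a :: l).getD i d) ((a :: l).getD (i + 1) d) := by
  induction l generalizing a with
  | nil => simp [listCost]
  | cons b l ih =>
    rw [listCost, ih, List.length_cons, Finset.sum_range_succ', add_comm]
    rfl

theorem sym2Weight_mk {w : V → V → ℝ} (hw : IsMetric w) (a b : V) :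
    sym2Weight w s(a, b) = w a b := by
  change (w a b + w b a) / 2 = w a b
  rw [hw.symm b a]
  ring

theorem sym2Weight_nonneg {w : V → V → ℝ} (hw : IsMetric w) (e : Sym2 V) :
    0 ≤ sym2Weight w e := by
  induction e with
  | _ a b =>
    rw [sym2Weight_mk hw]
    rcases eq_or_ne a b with rfl | h
    · exact (hw.self a).ge
    · exact (hw.pos a b h).le

theorem listCost_support {w : V → V → ℝ} (hw : IsMetric w) {G : SimpleGraph V} {u v : V}
    (p : G.Walk u v) : listCost w p.support = (p.edges.map (sym2Weight w)).sum := by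
  induction p with
  | nil => simp [listCost]
  | cons h p ih =>
    rw [SimpleGraph.Walk.support_cons, SimpleGraph.Walk.edges_cons, List.map_cons,
      List.sum_cons, ← ih, sym2Weight_mk hw, ← p.cons_tail_support, listCost]

theorem TSPcost_le_tourCost [Fintype V] (w : V → V → ℝ) (f : Fin (Fintype.card V) ≃ V) :
    TSPcost V w ≤ tourCost V w f := by
  refine csInf_le (Set.Finite.bddBelow ?_) ⟨f, rfl⟩
  refine (Set.finite_range fun f : Fin (Fintype.card V) ≃ V => tourCost V w f).subset ?_
  rintro x ⟨f, rfl⟩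
  exact ⟨f, rfl⟩

theorem TSPcost_le_listCost [Fintype V] (w : V → V → ℝ) (d : V) (l : List V)
    (hnd : (d :: l).Nodup) (hmem : ∀ v, v ∈ d :: l) :
    TSPcost V w ≤ listCost w (d :: (l ++ [d])) := by
  have hlen : (d :: l).length = Fintype.card V := by
    rw [← List.toFinset_card_of_nodup hnd, ← Finset.card_univ]
    congr 1
    ext v
    simpa using hmem v
  let f : Fin (Fintype.card V) ≃ V :=
    (finCongr hlen.symm).trans (List.Nodup.getEquivOfForallMemList (d :: l) hnd hmem)
  have hf : ∀ i, f i = (d :: l).getD i d := by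
    intro i
    have hi : (i : ℕ) < (d :: l).length := hlen.symm ▸ i.2
    rw [List.getD_eq_getElem _ _ hi]
    rfl
  refine (TSPcost_le_tourCost w f).trans_eq ?_
  have hlen' : (l ++ [d]).length = Fintype.card V := by simpa using hlen
  rw [listCost_eq_sum_range w d, tourCost, hlen', Finset.sum_range]
  refine Finset.sum_congr rfl fun i _ => ?_
  have hi : (i : ℕ) < l.length + 1 := by simpa [← hlen] using i.2
  have hcard : l.length + 1 = Fintype.card V := hlen
  rw [hf, hf, ← List.cons_append, List.getD_append _ _ _ _ (by simpa using hi)]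
  congr 1
  rcases Nat.lt_or_ge (i + 1) (l.length + 1) with h | h
  · simp only [Nat.mod_eq_of_lt (show (i : ℕ) + 1 < Fintype.card V by omega)]
    rw [List.getD_append _ _ _ _ (by simpa using h)]
  · have : (i : ℕ) + 1 = l.length + 1 := by omega
    rw [List.getD_append_right _ _ _ _ (by simpa using h)]
    simp only [this, hcard, Nat.mod_self]
    simp

theorem TSPcost_le_of_closed_walk [Fintype V] {w : V → V → ℝ} (hw : IsMetric w)
    {G : SimpleGraph V} {u : V} (p : G.Walk u u) (hp : ∀ v, v ∈ p.support) :
    TSPcost V w ≤ (p.edges.map (sym2Weight w)).sum := by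
  obtain ⟨d, l, hdl⟩ : ∃ d l, p.support.dedup = d :: l :=
    List.exists_cons_of_ne_nil fun h => by
      have := List.mem_dedup.2 (hp u)
      simp [h] at this
  have hsub : (d :: l).Sublist p.support := hdl ▸ List.dedup_sublist _
  have h1 := TSPcost_le_listCost w d l (hdl ▸ List.nodup_dedup _)
    (fun v => hdl ▸ List.mem_dedup.2 (hp v))
  have h2 := listCost_le_of_sublist w hw u hsub u
  have h3 : listCost w (u :: (p.support ++ [u])) = (p.edges.map (sym2Weight w)).sum := by
    rw [← listCost_support hw]
    obtain ⟨q, hq⟩ : ∃ q, p.support = q ++ [u] :=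
      ⟨p.support.dropLast, by
        conv_lhs => rw [← List.dropLast_append_getLast p.support_ne_nil]
        rw [p.getLast_support]⟩
    have h4 : listCost w (u :: (p.support ++ [u])) = listCost w (u :: p.support) := by
      rw [hq, List.append_assoc, ← List.cons_append]
      simp only [List.singleton_append]
      rw [listCost_append_singleton, hw.self, add_zero, List.cons_append]
    rw [h4, ← p.cons_tail_support, listCost, hw.self, zero_add]
  have h5 : listCost w (d :: (l ++ [d])) ≤ listCost w (u :: (d :: l ++ [u])) := by
    have key : ∀ q : List V, q ≠ [] →
        listCost w (q ++ [d]) ≤ listCost w (q ++ [u]) + w u d := by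
      intro q hq
      obtain ⟨q, x, rfl⟩ : ∃ q' x, q = q' ++ [x] :=
        ⟨q.dropLast, q.getLast hq, (List.dropLast_append_getLast hq).symm⟩
      simp only [List.append_assoc, List.singleton_append]
      rw [listCost_append_singleton, listCost_append_singleton]
      linarith [hw.triangle x u d]
    have := key (d :: l) (by simp)
    simp only [List.cons_append, listCost] at this ⊢
    linarith
  linarith

/-! ### Choosing a subset by averaging -/

/-- The expectation argument for a uniformly random subset `S` of `E`, in which the sign of
every `f` related to some element of `E` averages to zero. -/
theorem exists_subset_signed_sum_le {α β : Type*} (r : α → β → Prop) (F : Finset β)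
    (a : α → ℝ) (E : Finset α) (c : β → ℝ) :
    ∃ S ⊆ E, ∑ f ∈ F, (-1) ^ (S.filter (r · f)).card * c f + 2 * ∑ e ∈ S, a e ≤
      ∑ f ∈ F.filter (fun f => ∀ e ∈ E, ¬ r e f), c f + ∑ e ∈ E, a e := by
  induction E using Finset.induction_on generalizing c with
  | empty => exact ⟨∅, by simp, by simp⟩
  | insert x E hx ih =>
    obtain ⟨S, hS, h1⟩ := ih c
    obtain ⟨S', hS', h2⟩ := ih fun f => if r x f then - c f else c f
    have hx' : x ∉ S' := fun h => hx (hS' h)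
    have hsplit : ∑ f ∈ F with ∀ e ∈ E, ¬ r e f, c f +
        ∑ f ∈ F with ∀ e ∈ E, ¬ r e f, (if r x f then - c f else c f) =
        2 * ∑ f ∈ F with ∀ e ∈ insert x E, ¬ r e f, c f := by
      rw [← Finset.sum_add_distrib, Finset.mul_sum, Finset.sum_filter, Finset.sum_filter]
      refine Finset.sum_congr rfl fun f _ => ?_
      by_cases h : r x f <;> by_cases h' : ∀ e ∈ E, ¬ r e f <;>
        simp [h, h', two_mul]
    have hsign : ∑ f ∈ F, (-1 : ℝ) ^ ((insert x S').filter (r · f)).card * c f =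
        ∑ f ∈ F, (-1) ^ (S'.filter (r · f)).card * (if r x f then - c f else c f) := by
      refine Finset.sum_congr rfl fun f _ => ?_
      rw [Finset.filter_insert]
      split_ifs with h
      · rw [Finset.card_insert_of_notMem (by simp [hx']), pow_succ]
        ring
      · rfl
    by_cases hle : ∑ f ∈ F with ∀ e ∈ E, ¬ r e f, c f ≤
        ∑ f ∈ F with ∀ e ∈ insert x E, ¬ r e f, c f + a x
    · refine ⟨S, hS.trans (Finset.subset_insert _ _), ?_⟩
      rw [Finset.sum_insert hx]
      linarith
    · refine ⟨insert x S', Finset.insert_subset_insert _ hS', ?_⟩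
      rw [hsign, Finset.sum_insert hx, Finset.sum_insert hx']
      linarith

/-! ### Covering in trees -/

theorem covers_iff_mem_edges {T : SimpleGraph V} (hT : T.IsTree) {u v : V} {p : T.Walk u v}
    (hp : p.IsPath) (f : Sym2 V) : covers T s(u, v) f ↔ f ∈ p.edges := by
  constructor
  · rintro ⟨a, b, q, hab, hq, hf⟩
    rcases Sym2.eq_iff.1 hab with ⟨rfl, rfl⟩ | ⟨rfl, rfl⟩
    · rwa [(hT.existsUnique_path _ _).unique hp hq]
    · rw [(hT.existsUnique_path _ _).unique hp hq.reverse]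
      simpa using hf
  · exact fun hf => ⟨u, v, p, rfl, hp, hf⟩

theorem not_covers_of_isDiag {T : SimpleGraph V} (hT : T.IsTree) {e : Sym2 V} (he : e.IsDiag)
    (f : Sym2 V) : ¬ covers T e f := by
  induction e with
  | _ a b =>
    obtain rfl : a = b := he
    simp [covers_iff_mem_edges hT (SimpleGraph.Walk.IsPath.nil (u := a))]

theorem sum_edgeBoundary_covers [Fintype V] {T : SimpleGraph V} (hT : T.IsTree) (e : Sym2 V) :
    ∑ f ∈ T.edgeFinset with covers T e f, edgeBoundary f = edgeBoundary e := by
  induction e with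
  | _ a b =>
    obtain ⟨p, hp, -⟩ := hT.existsUnique_path a b
    rw [edgeBoundary_mk, ← sum_edgeBoundary_walk p, ← List.sum_toFinset _ hp.isTrail.edges_nodup]
    refine Finset.sum_congr ?_ fun _ _ => rfl
    ext f
    simp only [Finset.mem_filter, SimpleGraph.mem_edgeFinset, covers_iff_mem_edges hT hp,
      List.mem_toFinset, and_iff_right_iff_imp]
    exact fun hf => p.edges_subset_edgeSet hf

theorem TSPcost_le_of_subset [Fintype V] {w : V → V → ℝ} (hw : IsMetric w)
    {T : SimpleGraph V} (hT : T.IsTree) (S : Finset (Sym2 V)) (hS : ∀ e ∈ S, ¬ e.IsDiag) :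
    TSPcost V w ≤ ∑ f ∈ T.edgeFinset, sym2Weight w f +
      ∑ f ∈ T.edgeFinset with Even (S.filter (covers T · f)).card, sym2Weight w f +
      ∑ e ∈ S, sym2Weight w e := by
  set D := T.edgeFinset.filter fun f => Even (S.filter (covers T · f)).card with hD
  let M : Multiset (Sym2 V) := T.edgeFinset.val + D.val + S.val
  have hTdiag : ∀ e ∈ T.edgeFinset, ¬ e.IsDiag := fun e he =>
    T.not_isDiag_of_mem_edgeSet (SimpleGraph.mem_edgeFinset.1 he)
  have heven : (M.map edgeBoundary).sum = 0 := by
    have hcov : ∑ e ∈ S, edgeBoundary e =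
        ∑ f ∈ T.edgeFinset, (S.filter (covers T · f)).card • edgeBoundary f := by
      rw [← Finset.sum_congr rfl fun e _ => sum_edgeBoundary_covers hT e]
      simp_rw [Finset.sum_filter]
      rw [Finset.sum_comm]
      refine Finset.sum_congr rfl fun f _ => ?_
      rw [← Finset.sum_filter, Finset.sum_const]
    have hzero : ∀ f : Sym2 V, edgeBoundary f + (if Even (S.filter (covers T · f)).card then
        edgeBoundary f else 0) + (S.filter (covers T · f)).card • edgeBoundary f = 0 := by
      intro f
      have h2 := add_self_eq_zero_of_zmod_two (edgeBoundary f)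
      split_ifs with h
      · obtain ⟨k, hk⟩ := h
        rw [hk, h2, add_smul, ← smul_add, h2, smul_zero, zero_add]
      · obtain ⟨k, hk⟩ := Nat.not_even_iff_odd.1 h
        rw [hk, add_smul, one_smul, two_mul, add_smul, ← smul_add, h2, smul_zero, add_zero,
          zero_add, h2]
    have hsum : (M.map edgeBoundary).sum = ∑ f ∈ T.edgeFinset, edgeBoundary f +
        ∑ f ∈ D, edgeBoundary f + ∑ e ∈ S, edgeBoundary e := by
      simp only [M, Multiset.map_add, Multiset.sum_add]
      rfl
    rw [hsum, hcov, hD, Finset.sum_filter, ← Finset.sum_add_distrib, ← Finset.sum_add_distrib]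
    exact Finset.sum_eq_zero fun f _ => hzero f
  obtain ⟨u, p, hp, hsupp⟩ := exists_closed_walk_of_even hT.connected M
    (by
      intro e he
      simp only [M, Multiset.mem_add, Finset.mem_val] at he
      rcases he with (he | he) | he
      · exact hTdiag e he
      · exact hTdiag e (Finset.mem_of_mem_filter e he)
      · exact hS e he)
    heven
    (fun e he => by simp [M, he])
  refine (TSPcost_le_of_closed_walk hw p hsupp).trans ?_
  obtain ⟨R, hR⟩ := Multiset.le_iff_exists_add.1 hp
  have hnonneg : 0 ≤ (R.map (sym2Weight w)).sum :=
    Multiset.sum_nonneg fun x hx => by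
      obtain ⟨e, -, rfl⟩ := Multiset.mem_map.1 hx
      exact sym2Weight_nonneg hw e
  have hsum : (M.map (sym2Weight w)).sum = ∑ f ∈ T.edgeFinset, sym2Weight w f +
      ∑ f ∈ D, sym2Weight w f + ∑ e ∈ S, sym2Weight w e := by
    simp only [M, Multiset.map_add, Multiset.sum_add]
    rfl
  rw [← hsum, hR, Multiset.map_add, Multiset.sum_add, Multiset.map_coe, Multiset.sum_coe]
  linarith

/-- The bound on the cost of a tour given by the cover advantage of a single set of pairs. -/
theorem TSPcost_le_of_cover [Fintype V] {w : V → V → ℝ} (hw : IsMetric w)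
    {T : SimpleGraph V} (hT : T.IsTree) (E : Finset (Sym2 V)) (hE : ∀ e ∈ E, ¬ e.IsDiag) :
    TSPcost V w ≤ 2 * ∑ f ∈ T.edgeFinset, sym2Weight w f -
      (1 / 2) * (∑ f ∈ T.edgeFinset with ∃ e ∈ E, covers T e f, sym2Weight w f -
        ∑ e ∈ E, sym2Weight w e) := by
  obtain ⟨S, hSE, hS⟩ := exists_subset_signed_sum_le (covers T) T.edgeFinset (sym2Weight w) E
    (sym2Weight w)
  have h1 := TSPcost_le_of_subset hw hT S fun e he => hE e (hSE he)
  have h2 : ∑ f ∈ T.edgeFinset with Even (S.filter (covers T · f)).card, sym2Weight w f =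
      (1 / 2) * (∑ f ∈ T.edgeFinset, sym2Weight w f +
        ∑ f ∈ T.edgeFinset, (-1) ^ (S.filter (covers T · f)).card * sym2Weight w f) := by
    rw [← Finset.sum_add_distrib, Finset.mul_sum, Finset.sum_filter]
    refine Finset.sum_congr rfl fun f _ => ?_
    split_ifs with h
    · rw [h.neg_one_pow]
      ring
    · rw [(Nat.not_even_iff_odd.1 h).neg_one_pow]
      ring
  have h3 := Finset.sum_filter_add_sum_filter_not T.edgeFinset
    (fun f => ∃ e ∈ E, covers T e f) (sym2Weight w)
  have h4 := hS.trans (add_le_add (Finset.sum_congr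
    (s₂ := T.edgeFinset.filter fun f => ¬ ∃ e ∈ E, covers T e f) (by ext; simp)
    fun _ _ => rfl).le le_rfl)
  linarith

/-! ### Combining edge-disjoint subtrees -/

theorem setWeight_eq_sum [Fintype V] (w : V → V → ℝ) (S : Set (Sym2 V)) :
    setWeight w S = ∑ e ∈ S.toFinset, sym2Weight w e := by
  rw [setWeight, ← finsum_mem_coe_finset, Set.coe_toFinset]

theorem exists_adv_eq_advOf [Fintype V] (w : V → V → ℝ) (T : SimpleGraph V) (T' : T.Subgraph) :
    ∃ E : Set (Sym2 V), adv w T T' = advOf w T E T' := by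
  obtain ⟨E, -, hE⟩ := Set.Nonempty.csSup_mem (s := { x | ∃ E' : Set (Sym2 V),
    (∀ e ∈ E', ∃ u ∈ T'.verts, u ∈ e) ∧ x = advOf w T E' T' }) ⟨_, ∅, by simp, rfl⟩
    ((Set.finite_range fun E => advOf w T E T').subset (by
      rintro x ⟨E, -, rfl⟩
      exact ⟨E, rfl⟩))
  exact ⟨E, hE⟩

theorem sum_adv_le [Fintype V] {w : V → V → ℝ} (hw : IsMetric w)
    {T : SimpleGraph V} (hT : T.IsTree) {ι : Type*} [Fintype ι] (𝒯 : ι → T.Subgraph)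
    (hdisj : ∀ i j, i ≠ j → Disjoint (𝒯 i).edgeSet (𝒯 j).edgeSet) :
    ∃ E : Finset (Sym2 V), (∀ e ∈ E, ¬ e.IsDiag) ∧ ∑ i, adv w T (𝒯 i) ≤
      ∑ f ∈ T.edgeFinset with ∃ e ∈ E, covers T e f, sym2Weight w f -
        ∑ e ∈ E, sym2Weight w e := by
  choose A hA using fun i => exists_adv_eq_advOf w T (𝒯 i)
  let E : Finset (Sym2 V) := {e | ¬ e.IsDiag ∧ ∃ i, e ∈ A i}
  refine ⟨E, fun e he => (Finset.mem_filter.1 he).2.1, ?_⟩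
  simp only [hA, advOf, setWeight_eq_sum, Finset.sum_sub_distrib]
  refine sub_le_sub ?_ ?_
  · rw [← Finset.sum_biUnion]
    · refine Finset.sum_le_sum_of_subset_of_nonneg (fun f hf => ?_)
        fun f _ _ => sym2Weight_nonneg hw f
      simp only [Finset.mem_biUnion, Finset.mem_univ, true_and, Set.mem_toFinset] at hf
      obtain ⟨i, ⟨hfT, e, he, hef⟩, -⟩ := hf
      simp only [Finset.mem_filter, SimpleGraph.mem_edgeFinset]
      refine ⟨hfT, e, ?_, hef⟩
      simp only [E, Finset.mem_filter, Finset.mem_univ, true_and]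
      exact ⟨fun h => not_covers_of_isDiag hT h f hef, i, he⟩
    · intro i _ j _ hij
      rw [Function.onFun, Set.disjoint_toFinset]
      exact (hdisj i j hij).mono Set.inter_subset_right Set.inter_subset_right
  · have hsub : E ⊆ Finset.univ.biUnion fun i => (A i).toFinset := by
      intro e he
      simpa using (Finset.mem_filter.1 he).2.2
    refine (Finset.sum_le_sum_of_subset_of_nonneg hsub
      fun f _ _ => sym2Weight_nonneg hw f).trans ?_
    have : ∀ s : Finset ι, ∑ e ∈ s.biUnion (fun i => (A i).toFinset), sym2Weight w e ≤
        ∑ i ∈ s, ∑ e ∈ (A i).toFinset, sym2Weight w e := by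
      intro s
      induction s using Finset.induction_on with
      | empty => simp
      | insert i s hi ih =>
        rw [Finset.biUnion_insert, Finset.sum_insert hi]
        have h1 := Finset.sum_union_inter (s₁ := (A i).toFinset)
          (s₂ := s.biUnion fun i => (A i).toFinset) (f := sym2Weight w)
        have h2 : 0 ≤ ∑ e ∈ (A i).toFinset ∩ s.biUnion (fun i => (A i).toFinset),
          sym2Weight w e := Finset.sum_nonneg fun e _ => sym2Weight_nonneg hw e
        linarith
    exact this Finset.univ

/-- If `T` is a minimum spanning tree of the complete weighted graph on
`(V, w)` and `𝒯` is a collection of pairwise edge-disjoint subtrees of `T`, then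
`TSP(w) ≤ 2·MST(w) − (1/2)·∑_{T' ∈ 𝒯} adv(T')`. -/
theorem tsp_le_two_mst_sub_half_adv_sum
    {V : Type*} [Fintype V] [Nonempty V] (w : V → V → ℝ) (hw : IsMetric w)
    (T : SimpleGraph V) (hT : T.IsTree)
    (hTmst : setWeight w T.edgeSet = MSTcost V w)
    (k : ℕ) (𝒯 : Fin k → T.Subgraph)
    (hsub : ∀ i, IsSubtree T (𝒯 i))
    (hdisj : ∀ i j, i ≠ j → Disjoint (𝒯 i).edgeSet (𝒯 j).edgeSet) :
    TSPcost V w ≤ 2 * MSTcost V w - (1 / 2) * ∑ i, adv w T (𝒯 i) := by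
  obtain ⟨E, hE, hle⟩ := sum_adv_le hw hT 𝒯 hdisj
  have hcost := TSPcost_le_of_cover hw hT E hE
  have hmst : MSTcost V w = ∑ f ∈ T.edgeFinset, sym2Weight w f := by
    rw [← hTmst, setWeight_eq_sum]
    exact Finset.sum_congr (by ext; simp) fun _ _ => rfl
  linarith
end

section
/- Let T be a spanning tree of the complete graph on a finite vertex set V, and let E' be a finite set of pairs of vertices none of which is an edge of T. Define the multigraph H_{T,E'} on V whose edge multiset consists of the pairs in E' together with, for each edge f of T, two copies of f if f is covered by an even number of pairs in E', and one copy of f if f is covered by an odd number of pairs in E'. Then H_{T,E'} is connected and every vertex of H_{T,E'} has even degree. -/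
open scoped Classical

variable {V : Type*}

/-- The multiplicity, in the multigraph `H_{T,E'}`, of an edge `f` of the tree `T`:
two copies of `f` if `f` is covered by an even number of pairs of `E'`, and one copy
if it is covered by an odd number of pairs of `E'`. -/
noncomputable def treeEdgeMult (T : SimpleGraph V) (E' : Finset (Sym2 V))
    (f : Sym2 V) : ℕ :=
  if Even ((E'.filter (fun e => covers T e f)).card) then 2 else 1

/-- The degree of a vertex `v` in the multigraph `H_{T,E'}`, whose edge multiset consists
of the pairs of `E'` together with `treeEdgeMult T E' f` copies of each edge `f` of `T`. -/
noncomputable def multDegree [Fintype V] (T : SimpleGraph V) (E' : Finset (Sym2 V))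
    (v : V) : ℕ :=
  (E'.filter (fun e => v ∈ e)).card +
    ∑ᶠ f ∈ T.edgeSet, (if v ∈ f then treeEdgeMult T E' f else 0)

/-- In a tree, the pair `s(a, b)` covers exactly the edges of any path from `a` to `b`. -/
theorem covers_mk_iff {T : SimpleGraph V} (hT : T.IsAcyclic) {a b : V} {p : T.Walk a b}
    (hp : p.IsPath) (f : Sym2 V) : covers T s(a, b) f ↔ f ∈ p.edges := by
  refine ⟨?_, fun hf => ⟨a, b, p, rfl, hp, hf⟩⟩
  rintro ⟨u, v, q, he, hq, hf⟩
  rcases Sym2.eq_iff.mp he with ⟨rfl, rfl⟩ | ⟨rfl, rfl⟩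
  · have : q = p := congrArg Subtype.val ((hT.subsingleton_path _ _).elim ⟨q, hq⟩ ⟨p, hp⟩)
    rwa [← this]
  · have : q.reverse = p :=
      congrArg Subtype.val ((hT.subsingleton_path _ _).elim ⟨q.reverse, hq.reverse⟩ ⟨p, hp⟩)
    simpa [← this] using hf

/-- The number of tree edges at `w` covered by a pair `e` is odd exactly when `w` is an
endpoint of `e`. -/
theorem even_card_covers_incident_iff [Fintype V] {T : SimpleGraph V} (hT : T.IsTree)
    {e : Sym2 V} (he : ¬ e.IsDiag) (w : V) :
    Even (T.edgeFinset.filter (fun f => covers T e f ∧ w ∈ f)).card ↔ w ∉ e := by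
  induction e using Sym2.ind with
  | _ a b =>
    obtain ⟨p, hp⟩ := hT.connected.exists_isPath a b
    have hset : T.edgeFinset.filter (fun f => covers T s(a, b) f ∧ w ∈ f) =
        (p.edges.filter (fun f => w ∈ f)).toFinset := by
      ext f
      simp only [Finset.mem_filter, SimpleGraph.mem_edgeFinset, covers_mk_iff hT.isAcyclic hp,
        List.mem_toFinset, List.mem_filter, decide_eq_true_eq]
      exact ⟨fun h => h.2, fun h => ⟨p.edges_subset_edgeSet h.1, h⟩⟩
    rw [hset, List.toFinset_card_of_nodup (hp.isTrail.edges_nodup.filter _),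
      ← List.countP_eq_length_filter, hp.isTrail.even_countP_edges_iff]
    have hab : a ≠ b := by simpa using he
    simp [hab]

theorem natCast_treeEdgeMult (T : SimpleGraph V) (E' : Finset (Sym2 V)) (f : Sym2 V) :
    (treeEdgeMult T E' f : ZMod 2) = ((E'.filter (fun e => covers T e f)).card : ZMod 2) := by
  unfold treeEdgeMult
  split_ifs with h
  · rw [ZMod.natCast_eq_zero_iff_even.mpr h]
    rfl
  · rw [ZMod.natCast_eq_one_iff_odd.mpr (Nat.not_even_iff_odd.mp h)]
    rfl

theorem even_multDegree [Fintype V] {T : SimpleGraph V} (hT : T.IsTree) {E' : Finset (Sym2 V)}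
    (hE' : ∀ e ∈ E', ¬ e.IsDiag) (v : V) : Even (multDegree T E' v) := by
  have hsum : ((∑ f ∈ T.edgeFinset, if v ∈ f then treeEdgeMult T E' f else 0 : ℕ) : ZMod 2) =
      ((E'.filter (fun e => v ∈ e)).card : ZMod 2) := by
    calc ((∑ f ∈ T.edgeFinset, if v ∈ f then treeEdgeMult T E' f else 0 : ℕ) : ZMod 2)
        = ∑ f ∈ T.edgeFinset, ∑ e ∈ E', if covers T e f ∧ v ∈ f then (1 : ZMod 2) else 0 := by
          push_cast
          refine Finset.sum_congr rfl fun f _ => ?_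
          by_cases hv : v ∈ f <;> simp [hv, natCast_treeEdgeMult]
      _ = ∑ e ∈ E', if v ∈ e then (1 : ZMod 2) else 0 := by
          rw [Finset.sum_comm]
          refine Finset.sum_congr rfl fun e he => ?_
          have h := even_card_covers_incident_iff hT (hE' e he) v
          rw [Finset.sum_boole]
          split_ifs with hv
          · exact ZMod.natCast_eq_one_iff_odd.mpr
              (Nat.not_even_iff_odd.mp fun h' => h.mp h' hv)
          · exact ZMod.natCast_eq_zero_iff_even.mpr (h.mpr hv)
      _ = ((E'.filter (fun e => v ∈ e)).card : ZMod 2) := Finset.sum_boole _ _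
  rw [multDegree, ← SimpleGraph.coe_edgeFinset, finsum_mem_coe_finset,
    ← ZMod.natCast_eq_zero_iff_even, Nat.cast_add, hsum]
  exact CharTwo.add_self_eq_zero _

/-- For a spanning tree `T` of the complete graph on `V` and a finite set
`E'` of pairs of vertices, none of which is an edge of `T`, the multigraph `H_{T,E'}` is
connected and every vertex has even degree. -/
theorem multigraph_eulerian
    {V : Type*} [Fintype V] (T : SimpleGraph V) (hT : T.IsTree)
    (E' : Finset (Sym2 V))
    (hnotTree : ∀ e ∈ E', e ∉ T.edgeSet)
    (hnotDiag : ∀ e ∈ E', ¬ e.IsDiag) :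
    (SimpleGraph.fromEdgeSet ((E' : Set (Sym2 V)) ∪ T.edgeSet)).Connected ∧
      ∀ v : V, Even (multDegree T E' v) := by
  refine ⟨hT.connected.mono fun a b h => ?_, even_multDegree hT hnotDiag⟩
  exact (SimpleGraph.fromEdgeSet_adj _).mpr ⟨Or.inr h, h.ne⟩
end

section
/- Let T be a spanning tree of the complete graph on a finite vertex set V, let T' be a subtree of T, and let π be a cyclic ordering of a subset of V that includes every vertex of V(T'), each vertex appearing exactly once. Then the collection of consecutive pairs (v_i, v_{i+1}) of π (indices modulo the length of π) can be partitioned into two subcollections E_0 and E_1 such that every edge of T' is covered by some pair in E_0 and every edge of T' is covered by some pair in E_1. -/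
open scoped Classical

variable {V : Type*}

/-- The consecutive pair of the cyclic ordering `f : Fin m → V` at index `i`. -/
def tourPair (m : ℕ) (f : Fin m → V) (i : Fin m) : Sym2 V :=
  s(f i, f ⟨((i : ℕ) + 1) % m, Nat.mod_lt _ i.pos⟩)

/-- Deleting a finite set `F` of edges from an acyclic graph leaves more than `#F` components. -/
lemma card_lt_card_connectedComponent_deleteEdges {V : Type*} [Finite V] [Nonempty V]
    {G : SimpleGraph V} (hG : G.IsAcyclic) (F : Finset (Sym2 V))
    (hF : (F : Set (Sym2 V)) ⊆ G.edgeSet) :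
    F.card < Nat.card (G.deleteEdges (F : Set (Sym2 V))).ConnectedComponent := by
  induction F using Finset.induction_on with
  | empty => simp
  | insert e F he ih =>
    rw [Finset.coe_insert, Set.insert_subset_iff] at hF
    have hlt := ih hF.2
    rw [Finset.card_insert_of_notMem he]
    refine Nat.lt_of_le_of_lt hlt ?_
    set H := G.deleteEdges (F : Set (Sym2 V)) with hH
    set H' := G.deleteEdges ((insert e F : Finset (Sym2 V)) : Set (Sym2 V)) with hH'
    have hle : H' ≤ H := SimpleGraph.deleteEdges_anti (by simp)
    have hH'e : H' = H.deleteEdges {e} := by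
      rw [hH, hH', SimpleGraph.deleteEdges_deleteEdges, Finset.coe_insert, Set.union_singleton]
    have hsurj := SimpleGraph.ConnectedComponent.surjective_map_ofLE hle
    refine lt_of_le_of_ne (Nat.card_le_card_of_surjective _ hsurj) fun hcard => ?_
    have hinj := (hsurj.bijective_of_nat_card_le hcard.ge).1
    induction e using Sym2.ind with | _ u v
    have hadj : H.Adj u v := by
      rw [hH, SimpleGraph.deleteEdges_adj]
      exact ⟨hF.1, he⟩
    have hbridge : H.IsBridge s(u, v) :=
      SimpleGraph.isAcyclic_iff_forall_isBridge.1 (hG.anti (SimpleGraph.deleteEdges_le _)) hadj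
    have hnot : ¬ H'.Reachable u v := by
      rw [hH'e]
      exact SimpleGraph.isBridge_iff.1 hbridge
    refine hnot (SimpleGraph.ConnectedComponent.exact (hinj ?_))
    exact SimpleGraph.ConnectedComponent.sound hadj.reachable

/-- A property holding somewhere but not everywhere on a cycle fails right after some index
where it holds. -/
lemma exists_and_not_cyclic_succ {m : ℕ} {P : Fin m → Prop} {a b : Fin m} (ha : P a)
    (hb : ¬ P b) : ∃ i : Fin m, P i ∧ ¬ P ⟨((i : ℕ) + 1) % m, Nat.mod_lt _ i.pos⟩ := by
  by_contra! h
  have hall (k : ℕ) : P ⟨((a : ℕ) + k) % m, Nat.mod_lt _ a.pos⟩ := by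
    induction k with
    | zero => simpa [Nat.mod_eq_of_lt a.isLt] using ha
    | succ k ih => simpa [add_assoc] using h _ ih
  refine hb ?_
  convert hall (m - a + b) using 1
  ext
  have : (a : ℕ) + (m - a + b) = b + m := by omega
  simp [this, Nat.mod_eq_of_lt b.isLt]

/-- A hypergraph all of whose nonempty subfamilies of edges have a union larger than
their number has a proper two-colouring. -/
lemma exists_two_coloring_of_card_lt_card_biUnion {ι α : Type*} [DecidableEq α]
    (S : ι → Finset α) (F : Finset ι)
    (hS : ∀ F' ⊆ F, F'.Nonempty → F'.card < (F'.biUnion S).card) :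
    ∃ I : Set α, ∀ g ∈ F, (∃ i ∈ I, i ∈ S g) ∧ ∃ i ∈ Iᶜ, i ∈ S g := by
  induction F using Finset.strongInduction with
  | H F ih =>
    rcases F.eq_empty_or_nonempty with rfl | hF
    · exact ⟨∅, by simp⟩
    let X := F.biUnion S
    let L : (X → ℝ) →ₗ[ℝ] (F → ℝ) :=
      LinearMap.pi fun g => ∑ i : X with i.1 ∈ S g, LinearMap.proj i
    have hL : LinearMap.ker L ≠ ⊥ :=
      L.ker_ne_bot_of_finrank_lt (by simpa using hS F subset_rfl hF)
    obtain ⟨y, hy, hy0⟩ := (Submodule.ne_bot_iff _).1 hL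
    have hsum (g : ι) (hg : g ∈ F) : ∑ i : X with i.1 ∈ S g, y i = 0 := by
      simpa [L] using congrFun (LinearMap.mem_ker.1 hy) ⟨g, hg⟩
    obtain ⟨x, hx⟩ := Function.ne_iff.1 hy0
    let F₀ := {g ∈ F | ∀ i : X, i.1 ∈ S g → y i = 0}
    have hF₀ : F₀ ⊂ F := by
      obtain ⟨g, hg, hxg⟩ := Finset.mem_biUnion.1 x.2
      exact Finset.filter_ssubset.2 ⟨g, hg, fun h => hx (h x hxg)⟩
    obtain ⟨I₀, hI₀⟩ := ih F₀ hF₀ fun F' hF' => hS F' (hF'.trans hF₀.subset)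
    refine ⟨{a | ∃ h : a ∈ X, 0 < y ⟨a, h⟩ ∨ (y ⟨a, h⟩ = 0 ∧ a ∈ I₀)}, fun g hg => ?_⟩
    by_cases hgz : ∀ i : X, i.1 ∈ S g → y i = 0
    · obtain ⟨⟨i, hi, hig⟩, j, hj, hjg⟩ := hI₀ g (Finset.mem_filter.2 ⟨hg, hgz⟩)
      have hX {a : α} (ha : a ∈ S g) : a ∈ X := Finset.mem_biUnion.2 ⟨g, hg, ha⟩
      refine ⟨⟨i, ⟨hX hig, .inr ⟨hgz _ hig, hi⟩⟩, hig⟩, j, ?_, hjg⟩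
      rintro ⟨h, hpos | ⟨-, hj'⟩⟩
      · exact hpos.ne' (hgz _ hjg)
      · exact hj hj'
    · push Not at hgz
      obtain ⟨z, hzg, hz⟩ := hgz
      have hzm : z ∈ ({i : X | i.1 ∈ S g} : Finset X) := by simpa using hzg
      obtain ⟨i, hi, hipos⟩ :=
        Finset.exists_pos_of_sum_zero_of_exists_nonzero y (hsum g hg) ⟨z, hzm, hz⟩
      obtain ⟨j, hj, hjpos⟩ :=
        Finset.exists_pos_of_sum_zero_of_exists_nonzero (fun i => - y i)
          (by rw [Finset.sum_neg_distrib, hsum g hg, neg_zero]) ⟨z, hzm, neg_ne_zero.2 hz⟩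
      have hjneg : y j < 0 := neg_pos.1 hjpos
      refine ⟨⟨i, ⟨i.2, .inl hipos⟩, (Finset.mem_filter.1 hi).2⟩, j, ?_,
        (Finset.mem_filter.1 hj).2⟩
      rintro ⟨h, hpos | ⟨h0, -⟩⟩
      · exact hjneg.not_gt hpos
      · exact hjneg.ne h0

/-- If a closed tour visits both endpoints of every edge of a nonempty set `F` of edges of a
tree, then more than `#F` of its consecutive pairs cover an edge of `F`. -/
lemma card_lt_card_covering_tourPairs {V : Type*} [Finite V] {T : SimpleGraph V} (hT : T.IsTree)
    {m : ℕ} (f : Fin m → V) (F : Finset (Sym2 V)) (hF : (F : Set (Sym2 V)) ⊆ T.edgeSet)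
    (hne : F.Nonempty) (hvis : ∀ g ∈ F, ∀ v ∈ g, v ∈ Set.range f) :
    F.card < (F.biUnion fun g => {i | covers T (tourPair m f i) g}).card := by
  have := hT.connected.nonempty
  set H := T.deleteEdges (F : Set (Sym2 V)) with hH
  have hlt : F.card < Nat.card H.ConnectedComponent :=
    card_lt_card_connectedComponent_deleteEdges hT.isAcyclic F hF
  have hcover (i : Fin m) (u v : V) (hi : tourPair m f i = s(u, v)) (huv : ¬ H.Reachable u v) :
      ∃ g ∈ F, covers T (tourPair m f i) g := by
    obtain ⟨p, hp⟩ := (hT.connected u v).exists_isPath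
    by_contra! h
    exact huv ⟨p.toDeleteEdges _ fun g hg hgF => h g hgF ⟨u, v, p, hi, hp, hg⟩⟩
  have hvisit (c : H.ConnectedComponent) : ∃ i, H.connectedComponentMk (f i) = c := by
    induction c using SimpleGraph.ConnectedComponent.ind with | _ w
    obtain ⟨e, he⟩ := hne
    obtain ⟨x, hx⟩ : ∃ x, x ∈ e := ⟨_, Sym2.out_fst_mem e⟩
    have key {a b : V} (p : T.Walk a b) (hb : b ∈ Set.range f) :
        ∃ i, H.connectedComponentMk (f i) = H.connectedComponentMk a := by
      induction p with
      | nil => obtain ⟨i, rfl⟩ := hb; exact ⟨i, rfl⟩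
      | @cons a c b hac p ih =>
        by_cases hacF : s(a, c) ∈ F
        · obtain ⟨i, hi⟩ := hvis _ hacF a (Sym2.mem_mk_left a c)
          exact ⟨i, by rw [hi]⟩
        · obtain ⟨i, hi⟩ := ih hb
          have hadj : H.Adj a c := by
            rw [hH, SimpleGraph.deleteEdges_adj]
            exact ⟨hac, hacF⟩
          exact ⟨i, hi.trans (SimpleGraph.ConnectedComponent.sound hadj.symm.reachable)⟩
    exact key (hT.connected w x).some (hvis e he x hx)
  have hexit (c : H.ConnectedComponent) : ∃ i : Fin m, H.connectedComponentMk (f i) = c ∧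
      H.connectedComponentMk (f ⟨((i : ℕ) + 1) % m, Nat.mod_lt _ i.pos⟩) ≠ c := by
    have : Nontrivial H.ConnectedComponent :=
      Finite.one_lt_card_iff_nontrivial.1 (Nat.lt_of_le_of_lt hne.card_pos hlt)
    obtain ⟨d, hd⟩ := exists_ne c
    obtain ⟨i, hi⟩ := hvisit c
    obtain ⟨j, hj⟩ := hvisit d
    exact exists_and_not_cyclic_succ (P := fun i => H.connectedComponentMk (f i) = c) hi
      (b := j) (by rwa [hj])
  choose t ht ht' using hexit
  have hinj : Function.Injective t := fun c d h => by rw [← ht c, ← ht d, h]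
  refine hlt.trans_le ?_
  have := Fintype.ofFinite H.ConnectedComponent
  rw [Nat.card_eq_fintype_card, ← Finset.card_univ]
  refine Finset.card_le_card_of_injOn t (fun c _ => ?_) hinj.injOn
  obtain ⟨g, hg, hcov⟩ := hcover (t c) _ _ rfl fun hr =>
    ht' c ((SimpleGraph.ConnectedComponent.sound hr).symm.trans (ht c))
  simpa using ⟨g, hg, hcov⟩

/-- Let `T` be a spanning tree of the complete graph on `V`, `T'` a
subtree of `T`, and `π` a cyclic ordering (given by an injective `f : Fin m → V`) of a
subset of `V` containing every vertex of `V(T')`. Then the consecutive pairs of `π` can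
be split into two subcollections (indices in `I` and indices in `Iᶜ`) such that every
edge of `T'` is covered by some pair of each subcollection. -/
theorem tour_edges_into_two_covers
    {V : Type*} [Fintype V] (T : SimpleGraph V) (hT : T.IsTree)
    (T' : T.Subgraph) (hT' : IsSubtree T T')
    (m : ℕ) (f : Fin m → V) (hinj : Function.Injective f)
    (hall : T'.verts ⊆ Set.range f) :
    ∃ I : Set (Fin m),
      (∀ g ∈ T'.edgeSet, ∃ i ∈ I, covers T (tourPair m f i) g) ∧
      (∀ g ∈ T'.edgeSet, ∃ i ∈ Iᶜ, covers T (tourPair m f i) g) := by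
  obtain ⟨I, hI⟩ := exists_two_coloring_of_card_lt_card_biUnion
    (fun g => {i | covers T (tourPair m f i) g}) T'.edgeSet.toFinset fun F hF hne =>
      have hF' {g : Sym2 V} (hg : g ∈ F) : g ∈ T'.edgeSet := Set.mem_toFinset.1 (hF hg)
      card_lt_card_covering_tourPairs hT f F (fun _ hg => T'.edgeSet_subset (hF' hg)) hne
        fun _ hg _ hv => hall (T'.mem_verts_of_mem_edge (hF' hg) hv)
  simp only [Set.mem_toFinset, Finset.mem_filter_univ] at hI
  exact ⟨I, fun g hg => (hI g hg).1, fun g hg => (hI g hg).2⟩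
end

section
/- Let T be a minimum spanning tree of the complete weighted graph on (V, w) and let T' be any subtree of T. Then TSP(w) ≥ 2·w(T') − 2·adv*(T'), where w(T') is the total weight of the edges of T'. -/
open scoped Classical

variable {V : Type*}

/-- The total `w`-length of the path visiting the points of a list in order. -/
def pathLength (w : V → V → ℝ) : List V → ℝ
  | [] => 0
  | [_] => 0
  | a :: b :: l => w a b + pathLength w (b :: l)

/-- The total `w`-length of the closed tour visiting the points of a list in cyclic order. -/
def cycleLength (w : V → V → ℝ) : List V → ℝ
  | [] => 0
  | a :: l => pathLength w (a :: (l ++ [a]))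

/-- Pair up consecutive entries of a list: first with second, third with fourth, and so on. -/
def consecutivePairs : List V → List (Sym2 V)
  | [] => []
  | [_] => []
  | a :: b :: l => s(a, b) :: consecutivePairs l

/-- The total `w`-weight of the pairs of consecutive entries of a list. -/
noncomputable def pairsWeight (w : V → V → ℝ) (l : List V) : ℝ :=
  ((consecutivePairs l).map (sym2Weight w)).sum

namespace IsMetric

variable {w : V → V → ℝ}

lemma nonneg (hw : IsMetric w) (x y : V) : 0 ≤ w x y := by
  by_cases h : x = y
  · rw [h, hw.self]
  · exact (hw.pos x y h).le

lemma sym2Weight_mk (hw : IsMetric w) (x y : V) : sym2Weight w s(x, y) = w x y := by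
  simp [sym2Weight, hw.symm y x]

lemma sym2Weight_nonneg (hw : IsMetric w) (e : Sym2 V) : 0 ≤ sym2Weight w e := by
  induction e with
  | _ x y => rw [hw.sym2Weight_mk]; exact hw.nonneg x y

lemma pathLength_cons_le (hw : IsMetric w) (x a : V) (l : List V) :
    pathLength w (x :: l) ≤ w x a + pathLength w (a :: l) := by
  cases l with
  | nil => simpa [pathLength] using hw.nonneg x a
  | cons b l =>
    simp only [pathLength]
    linarith [hw.triangle x a b]

lemma pathLength_cons_sublist (hw : IsMetric w) {l l' : List V} (h : l'.Sublist l) (x : V) :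
    pathLength w (x :: l') ≤ pathLength w (x :: l) := by
  induction h generalizing x with
  | slnil => exact le_rfl
  | @cons l' l a _ ih =>
    exact (ih x).trans (hw.pathLength_cons_le x a l)
  | cons_cons a _ ih =>
    simp only [pathLength]
    linarith [ih a]

lemma pathLength_concat_le (hw : IsMetric w) (l : List V) (y a : V) :
    pathLength w (l ++ [y]) ≤ pathLength w (l ++ [a]) + w a y := by
  induction l with
  | nil => simpa [pathLength] using hw.nonneg a y
  | cons b l ih =>
    cases l with
    | nil => simpa [pathLength] using hw.triangle b a y
    | cons c l =>
      simp only [List.cons_append, pathLength] at ih ⊢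
      linarith

lemma cycleLength_nonneg (hw : IsMetric w) (l : List V) : 0 ≤ cycleLength w l := by
  have key : ∀ m : List V, 0 ≤ pathLength w m := by
    intro m
    induction m with
    | nil => exact le_rfl
    | cons a m ih =>
      cases m with
      | nil => exact le_rfl
      | cons b m => exact add_nonneg (hw.nonneg a b) ih
  cases l with
  | nil => exact le_rfl
  | cons a l => exact key _

lemma cycleLength_sublist (hw : IsMetric w) {l l' : List V} (h : l'.Sublist l) :
    cycleLength w l' ≤ cycleLength w l := by
  induction h with
  | slnil => exact le_rfl
  | @cons l' l a _ ih =>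
    refine ih.trans ?_
    cases l with
    | nil => exact hw.cycleLength_nonneg [a]
    | cons y l =>
      have := hw.pathLength_concat_le (y :: l) y a
      simp only [cycleLength, List.cons_append, pathLength] at this ⊢
      linarith
  | cons_cons a h _ => exact hw.pathLength_cons_sublist (h.append_right [a]) a

lemma pairsWeight_cons_add (hw : IsMetric w) (a : V) (l : List V) :
    pairsWeight w (a :: l) + pairsWeight w l = pathLength w (a :: l) := by
  induction l generalizing a with
  | nil => simp [pairsWeight, consecutivePairs, pathLength]
  | cons b l ih =>
    have := ih b
    simp only [pairsWeight, consecutivePairs, pathLength, List.map_cons, List.sum_cons,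
      hw.sym2Weight_mk] at this ⊢
    linarith

lemma pairsWeight_le_concat (hw : IsMetric w) (y : V) (l : List V) :
    pairsWeight w l ≤ pairsWeight w (l ++ [y]) := by
  induction l using consecutivePairs.induct with
  | case1 => simp [pairsWeight, consecutivePairs]
  | case2 a => simpa [pairsWeight, consecutivePairs] using hw.sym2Weight_nonneg s(a, y)
  | case3 a b l ih =>
    simp only [pairsWeight, consecutivePairs, List.cons_append, List.map_cons,
      List.sum_cons] at ih ⊢
    linarith

lemma exists_perm_two_mul_pairsWeight_le (hw : IsMetric w) (l : List V) :
    ∃ m : List V, m.Perm l ∧ 2 * pairsWeight w m ≤ cycleLength w l := by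
  cases l with
  | nil => exact ⟨[], List.Perm.refl _, by simp [pairsWeight, consecutivePairs, cycleLength]⟩
  | cons a l =>
    have h := hw.pairsWeight_cons_add a (l ++ [a])
    have h' := hw.pairsWeight_le_concat a (a :: l)
    rw [List.cons_append] at h'
    by_cases hle : pairsWeight w (a :: l) ≤ pairsWeight w (l ++ [a])
    · refine ⟨a :: l, List.Perm.refl _, ?_⟩
      simp only [cycleLength]
      linarith
    · refine ⟨l ++ [a], List.perm_append_singleton a l, ?_⟩
      simp only [cycleLength]
      linarith

lemma setWeight_toFinset_le (hw : IsMetric w) (l : List (Sym2 V)) :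
    setWeight w (l.toFinset : Set (Sym2 V)) ≤ (l.map (sym2Weight w)).sum := by
  rw [setWeight, finsum_mem_coe_finset]
  induction l with
  | nil => simp
  | cons e l ih =>
    rw [List.toFinset_cons, List.map_cons, List.sum_cons]
    by_cases he : e ∈ l.toFinset
    · rw [Finset.insert_eq_of_mem he]
      linarith [hw.sym2Weight_nonneg e]
    · rw [Finset.sum_insert he]
      linarith

end IsMetric

lemma pathLength_map_range (w : V → V → ℝ) (g : ℕ → V) (k : ℕ) :
    pathLength w ((List.range (k + 1)).map g) = ∑ i ∈ Finset.range k, w (g i) (g (i + 1)) := by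
  induction k generalizing g with
  | zero => simp [pathLength]
  | succ k ih =>
    have h := ih (fun i => g (i + 1))
    rw [Finset.sum_range_succ', ← h, List.range_succ_eq_map, List.range_succ_eq_map]
    simp only [List.map_cons, List.map_map, pathLength, Function.comp_def, zero_add,
      Nat.succ_eq_add_one]
    ring

lemma exists_nodup_list_cycleLength_eq_tourCost [Fintype V] (hV : 0 < Fintype.card V)
    (w : V → V → ℝ) (f : Fin (Fintype.card V) ≃ V) :
    ∃ l : List V, l.Nodup ∧ (∀ v, v ∈ l) ∧ cycleLength w l = tourCost V w f := by
  let g : ℕ → V := fun i => f ⟨i % Fintype.card V, Nat.mod_lt _ hV⟩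
  refine ⟨(List.range (Fintype.card V)).map g, ?_, ?_, ?_⟩
  · refine List.Nodup.map_on ?_ List.nodup_range
    intro i hi j hj hij
    have := congrArg Fin.val (f.injective hij)
    rw [List.mem_range] at hi hj
    simpa [Nat.mod_eq_of_lt hi, Nat.mod_eq_of_lt hj] using this
  · intro v
    refine List.mem_map.2 ⟨f.symm v, List.mem_range.2 (f.symm v).2, ?_⟩
    have : (⟨(f.symm v : ℕ) % Fintype.card V, Nat.mod_lt _ hV⟩ : Fin (Fintype.card V)) = f.symm v :=
      Fin.ext (Nat.mod_eq_of_lt (f.symm v).2)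
    simp only [g]
    rw [this, f.apply_symm_apply]
  · have hcycle (n : ℕ) (hn : 0 < n) (hg : g n = g 0) : cycleLength w ((List.range n).map g) =
        pathLength w ((List.range (n + 1)).map g) := by
      obtain ⟨k, rfl⟩ : ∃ k, n = k + 1 := ⟨n - 1, by omega⟩
      rw [List.range_succ (n := k + 1), List.map_append, List.map_singleton, hg,
        List.range_succ_eq_map]
      rfl
    rw [hcycle _ hV (by simp [g]), pathLength_map_range, tourCost, Finset.sum_range]
    refine Finset.sum_congr rfl fun i _ => ?_
    have : (⟨(i : ℕ) % Fintype.card V, Nat.mod_lt _ hV⟩ : Fin (Fintype.card V)) = i := Fin.ext (Nat.mod_eq_of_lt i.2)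
    simp only [g]
    rw [this]

lemma exists_consecutivePairs_separated (S : Set V) (l : List V) (hl : Even l.length)
    (hS : Odd (l.countP (· ∈ S))) :
    ∃ u v, s(u, v) ∈ consecutivePairs l ∧ u ∈ S ∧ v ∉ S := by
  induction l using consecutivePairs.induct with
  | case1 => simp at hS
  | case2 a => simp at hl
  | case3 a b l ih =>
    by_cases ha : a ∈ S <;> by_cases hb : b ∈ S
    · obtain ⟨u, v, h, huv⟩ := ih (by simpa [Nat.even_add_one] using hl)
        (by simpa [ha, hb, Nat.odd_add_one] using hS)
      exact ⟨u, v, List.mem_cons_of_mem _ h, huv⟩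
    · exact ⟨a, b, List.mem_cons_self, ha, hb⟩
    · exact ⟨b, a, by simp [consecutivePairs, Sym2.eq_swap], hb, ha⟩
    · obtain ⟨u, v, h, huv⟩ := ih (by simpa [Nat.even_add_one] using hl)
        (by simpa [ha, hb] using hS)
      exact ⟨u, v, List.mem_cons_of_mem _ h, huv⟩

lemma mem_of_mem_consecutivePairs {l : List V} {e : Sym2 V} (he : e ∈ consecutivePairs l) :
    ∃ u ∈ l, u ∈ e := by
  induction l using consecutivePairs.induct with
  | case1 => simp [consecutivePairs] at he
  | case2 a => simp [consecutivePairs] at he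
  | case3 a b l ih =>
    rw [consecutivePairs, List.mem_cons] at he
    rcases he with rfl | he
    · exact ⟨a, List.mem_cons_self, Sym2.mem_mk_left a b⟩
    · obtain ⟨u, hu, hue⟩ := ih he
      exact ⟨u, by simp [hu], hue⟩

lemma countP_eq_card_filter [Fintype V] {l : List V} (hl : l.Nodup) {P : V → Prop}
    (hP : ∀ v, v ∈ l ↔ P v) (S : Set V) :
    l.countP (· ∈ S) = (Finset.univ.filter fun v => v ∈ S ∧ P v).card := by
  rw [List.countP_eq_length_filter, ← List.toFinset_card_of_nodup (hl.filter _)]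
  congr 1
  ext v
  simp [hP, and_comm]

lemma covers_of_separated {T : SimpleGraph V} (hT : T.Connected) {S : Set V} {f : Sym2 V}
    (hS : ∀ x y, T.Adj x y → s(x, y) ≠ f → x ∈ S → y ∈ S) {u v : V} (hu : u ∈ S) (hv : v ∉ S) :
    covers T s(u, v) f := by
  obtain ⟨p, hp⟩ := hT.exists_isPath u v
  refine ⟨u, v, p, rfl, hp, ?_⟩
  clear hp
  by_contra hf
  induction p with
  | nil => exact hv hu
  | cons h p ih =>
    rw [SimpleGraph.Walk.edges_cons, List.mem_cons, not_or] at hf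
    exact ih (hS _ _ h (Ne.symm hf.1) hu) hv hf.2

lemma even_card_odd_ncard_neighborSet [Fintype V] {T : SimpleGraph V} (T' : T.Subgraph) :
    Even (Finset.univ.filter fun v => Odd (T'.neighborSet v).ncard).card := by
  convert T'.spanningCoe.even_card_odd_degree_vertices using 5 with v
  rw [← SimpleGraph.card_neighborSet_eq_degree, ← Nat.card_eq_fintype_card]
  rfl

lemma odd_card_odd_ncard_neighborSet_of_cut [Fintype V] {T : SimpleGraph V} (T' : T.Subgraph)
    {S : Set V} {a b : V} (hab : T'.Adj a b) (ha : a ∈ S) (hb : b ∉ S)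
    (hS : ∀ x y, T.Adj x y → s(x, y) ≠ s(a, b) → x ∈ S → y ∈ S) :
    Odd (Finset.univ.filter fun v => v ∈ S ∧ Odd (T'.neighborSet v).ncard).card := by
  let H : SimpleGraph V :=
    { Adj := fun x y => T'.Adj x y ∧ x ∈ S ∧ y ∈ S
      symm := ⟨fun _ _ h => ⟨h.1.symm, h.2.2, h.2.1⟩⟩
      loopless := ⟨fun x h => T'.loopless.irrefl x h.1⟩ }
  have hdeg (v : V) : H.degree v = (H.neighborSet v).ncard := by
    rw [← SimpleGraph.card_neighborSet_eq_degree, ← Nat.card_eq_fintype_card]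
    rfl
  have hout (v : V) (hv : v ∉ S) : H.degree v = 0 := by
    rw [hdeg, Set.ncard_eq_zero]
    ext x
    simp [H, hv]
  have hin (v : V) (hv : v ∈ S) :
      (T'.neighborSet v).ncard = H.degree v + if v = a then 1 else 0 := by
    rw [hdeg]
    split_ifs with hva
    · subst hva
      have : T'.neighborSet v = insert b (H.neighborSet v) := by
        ext x
        simp only [SimpleGraph.Subgraph.mem_neighborSet, Set.mem_insert_iff,
          SimpleGraph.mem_neighborSet, H]
        constructor
        · intro h
          by_cases hx : x = b
          · exact Or.inl hx
          · refine Or.inr ⟨h, hv, hS v x h.adj_sub ?_ hv⟩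
            intro h'
            exact hx (Sym2.congr_right.1 h')
        · rintro (rfl | h)
          · exact hab
          · exact h.1
      rw [this, Set.ncard_insert_of_notMem (fun h => hb h.2.2)]
    · rw [add_zero]
      congr 1
      ext x
      simp only [SimpleGraph.Subgraph.mem_neighborSet, SimpleGraph.mem_neighborSet, H]
      refine ⟨fun h => ⟨h, hv, hS v x h.adj_sub ?_ hv⟩, fun h => h.1⟩
      intro h'
      rcases Sym2.eq_iff.1 h' with h' | h'
      · exact hva h'.1
      · exact hb (h'.1 ▸ hv)
  have hsum : ∑ v ∈ Finset.univ.filter (· ∈ S), (T'.neighborSet v).ncard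
      = ∑ v, H.degree v + 1 := by
    rw [Finset.sum_congr rfl (fun v hv => hin v (Finset.mem_filter.1 hv).2),
      Finset.sum_add_distrib, Finset.sum_ite_eq', if_pos (by simpa using ha),
      Finset.sum_filter_of_ne]
    intro v _ hv
    by_contra hvS
    exact hv (hout v hvS)
  rw [← Finset.filter_filter, ← Finset.odd_sum_iff_odd_card_odd, hsum,
    H.sum_degrees_eq_twice_card_edges]
  exact odd_two_mul_add_one _

lemma SimpleGraph.IsAcyclic.exists_cut {T : SimpleGraph V} (hT : T.IsAcyclic) {a b : V}
    (hab : T.Adj a b) :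
    ∃ S : Set V, a ∈ S ∧ b ∉ S ∧ ∀ x y, T.Adj x y → s(x, y) ≠ s(a, b) → x ∈ S → y ∈ S := by
  have hbr : ¬ (T.deleteEdges {s(a, b)}).Reachable a b :=
    SimpleGraph.isBridge_iff.1 (SimpleGraph.isAcyclic_iff_forall_adj_isBridge.1 hT hab)
  refine ⟨{x | (T.deleteEdges {s(a, b)}).Reachable a x}, SimpleGraph.Reachable.refl _, hbr, ?_⟩
  intro x y hxy hne hx
  refine SimpleGraph.Reachable.trans hx (SimpleGraph.Adj.reachable ?_)
  rw [SimpleGraph.deleteEdges_adj]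
  exact ⟨hxy, hne⟩

/-- Pairing up the odd-degree vertices of a subgraph of a tree, in any order, covers every edge
of that subgraph. -/
lemma covOn_consecutivePairs_eq_edgeSet [Fintype V] {T : SimpleGraph V} (hT : T.IsTree)
    (T' : T.Subgraph) {l : List V} (hl : l.Nodup)
    (hodd : ∀ v, v ∈ l ↔ Odd (T'.neighborSet v).ncard) :
    covOn T ((consecutivePairs l).toFinset : Set (Sym2 V)) T' = T'.edgeSet := by
  refine Set.inter_eq_right.2 fun f hf => ⟨T'.edgeSet_subset hf, ?_⟩
  induction f with
  | _ a b =>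
    have hab : T'.Adj a b := hf
    obtain ⟨S, ha, hb, hS⟩ := hT.isAcyclic.exists_cut hab.adj_sub
    have hlen : Even l.length := by
      have h := countP_eq_card_filter hl hodd Set.univ
      simp only [Set.mem_univ, decide_true, List.countP_true, true_and] at h
      rw [h]
      exact even_card_odd_ncard_neighborSet T'
    have hcount : Odd (l.countP (· ∈ S)) := by
      rw [countP_eq_card_filter hl hodd]
      convert odd_card_odd_ncard_neighborSet_of_cut T' hab ha hb hS
    obtain ⟨u, v, huv, hu, hv⟩ := exists_consecutivePairs_separated S l hlen hcount
    exact ⟨s(u, v), by simpa using huv, covers_of_separated hT.connected hS hu hv⟩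

lemma isSpecial_of_odd {T : SimpleGraph V} {T' : T.Subgraph} {v : V}
    (h : Odd (T'.neighborSet v).ncard) : IsSpecial T T' v := by
  constructor
  · obtain ⟨x, hx⟩ := Set.nonempty_of_ncard_ne_zero h.pos.ne'
    exact T'.edge_vert hx
  · intro h2
    rw [h2] at h
    exact absurd h (by decide)

lemma advOf_le_advStar [Fintype V] (w : V → V → ℝ) (T : SimpleGraph V) (T' : T.Subgraph)
    {E' : Set (Sym2 V)} (hE' : ∀ e ∈ E', ∃ u, IsSpecial T T' u ∧ u ∈ e) :
    advOf w T E' T' ≤ advStar w T T' := by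
  refine le_csSup (Set.Finite.bddAbove ?_) ⟨E', hE', rfl⟩
  refine (Set.finite_range fun E : Set (Sym2 V) => advOf w T E T').subset ?_
  rintro x ⟨E, _, rfl⟩
  exact ⟨E, rfl⟩

/-- If `T` is a minimum spanning tree of the complete weighted graph on
`(V, w)` and `T'` is any subtree of `T`, then `TSP(w) ≥ 2·w(T') − 2·adv*(T')`. -/
theorem tsp_ge_two_subtree_weight_sub_two_advStar
    {V : Type*} [Fintype V] (hn : 2 ≤ Fintype.card V)
    (w : V → V → ℝ) (hw : IsMetric w)
    (T : SimpleGraph V) (hT : T.IsTree)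
    (hTmst : setWeight w T.edgeSet = MSTcost V w)
    (T' : T.Subgraph) (hT' : IsSubtree T T') :
    2 * setWeight w T'.edgeSet - 2 * advStar w T T' ≤ TSPcost V w := by
  refine le_csInf ⟨_, (Fintype.equivFin V).symm, rfl⟩ ?_
  rintro x ⟨f, rfl⟩
  obtain ⟨l, hl, hmem, hcost⟩ := exists_nodup_list_cycleLength_eq_tourCost (by omega) w f
  obtain ⟨m, hperm, hm⟩ := hw.exists_perm_two_mul_pairsWeight_le
    (l.filter fun v => Odd (T'.neighborSet v).ncard)
  have hsub := hw.cycleLength_sublist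
    (List.filter_sublist (p := fun v => decide (Odd (T'.neighborSet v).ncard)) (l := l))
  have hodd (v : V) : v ∈ m ↔ Odd (T'.neighborSet v).ncard := by
    rw [hperm.mem_iff]
    simp [hmem]
  have hcov := covOn_consecutivePairs_eq_edgeSet hT T' (hperm.nodup_iff.2 (hl.filter _)) hodd
  have hadv := advOf_le_advStar w T T' (E' := ((consecutivePairs m).toFinset : Set (Sym2 V)))
    (by
      intro e he
      obtain ⟨u, hu, hue⟩ := mem_of_mem_consecutivePairs (List.mem_toFinset.1 he)
      exact ⟨u, isSpecial_of_odd ((hodd u).1 hu), hue⟩)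
  have hweight := hw.setWeight_toFinset_le (consecutivePairs m)
  rw [advOf, hcov] at hadv
  rw [pairsWeight] at hm
  linarith
end

section
/- Every tree with n ≥ 2 vertices and exactly L leaves contains a matching of size at least (n − L)/2. -/
open scoped Classical

namespace SimpleGraph

variable {V : Type*} {G : SimpleGraph V}

/-- In a tree rooted at `r`, every vertex has at most one parent. -/
theorem IsTree.eq_of_adj_of_dist_add_one (hG : G.IsTree) {r v w₁ w₂ : V}
    (h₁ : G.Adj w₁ v) (h₂ : G.Adj w₂ v) (d₁ : G.dist r w₁ + 1 = G.dist r v)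
    (d₂ : G.dist r w₂ + 1 = G.dist r v) : w₁ = w₂ := by
  obtain ⟨p₁, hp₁⟩ := hG.connected.exists_walk_length_eq_dist r w₁
  obtain ⟨p₂, hp₂⟩ := hG.connected.exists_walk_length_eq_dist r w₂
  have q₁ : (p₁.concat h₁).IsPath :=
    Walk.isPath_of_length_eq_dist _ (by rw [Walk.length_concat, hp₁, d₁])
  have q₂ : (p₂.concat h₂).IsPath :=
    Walk.isPath_of_length_eq_dist _ (by rw [Walk.length_concat, hp₂, d₂])
  have h := congrArg Subtype.val ((hG.isAcyclic.subsingleton_path r v).elim ⟨_, q₁⟩ ⟨_, q₂⟩)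
  exact (Walk.concat_inj h).1

/-- In a nontrivial tree rooted at `r`, every vertex which is not a leaf has a child. -/
theorem IsTree.exists_adj_dist_eq_add_one [Nontrivial V] (hG : G.IsTree) (r : V) {v : V}
    (hv : (G.neighborSet v).ncard ≠ 1) : ∃ w, G.Adj v w ∧ G.dist r w = G.dist r v + 1 := by
  by_contra! h
  have parent : ∀ w, G.Adj v w → G.dist r w + 1 = G.dist r v := by
    intro w hw
    have := hG.dist_eq_dist_add_one_of_adj r hw
    have := h w hw
    omega
  obtain ⟨w, hw⟩ := hG.connected.preconnected.exists_adj_of_nontrivial v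
  refine hv (Set.ncard_eq_one.2 ⟨w, Set.eq_singleton_iff_unique_mem.2 ⟨hw, fun x hx => ?_⟩⟩)
  exact hG.eq_of_adj_of_dist_add_one (Adj.symm hx) hw.symm (parent x hx) (parent w hw)

/-- An injective choice of neighbours outside `s` for the vertices of `s` gives a matching with
at least as many edges as `s` has elements. -/
theorem exists_isMatching_ncard_le [Finite V] (s : Set V) (c : V → V)
    (hadj : ∀ v ∈ s, G.Adj v (c v)) (hc : ∀ v ∈ s, c v ∉ s) (hinj : Set.InjOn c s) :
    ∃ M : G.Subgraph, M.IsMatching ∧ s.ncard ≤ M.edgeSet.ncard := by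
  let M : G.Subgraph :=
    { verts := s ∪ c '' s
      Adj := fun a b => (a ∈ s ∧ c a = b) ∨ (b ∈ s ∧ c b = a)
      adj_sub := by
        rintro a b (⟨h, rfl⟩ | ⟨h, rfl⟩)
        exacts [hadj a h, (hadj b h).symm]
      edge_vert := by
        rintro a b (⟨h, -⟩ | ⟨h, rfl⟩)
        exacts [Or.inl h, Or.inr ⟨b, h, rfl⟩]
      symm := ⟨fun _ _ h => h.symm⟩ }
  refine ⟨M, ?_, ?_⟩
  · rintro v (hv | ⟨u, hu, rfl⟩)
    · refine ⟨c v, Or.inl ⟨hv, rfl⟩, ?_⟩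
      rintro w (⟨-, h⟩ | ⟨hw, rfl⟩)
      exacts [h.symm, absurd hv (hc w hw)]
    · refine ⟨u, Or.inr ⟨hu, rfl⟩, ?_⟩
      rintro w (⟨h, -⟩ | ⟨hw, h⟩)
      exacts [absurd h (hc u hu), hinj hw hu h]
  · refine Set.ncard_le_ncard_of_injOn (fun v => s(v, c v)) ?_ ?_ (Set.toFinite _)
    · exact fun v hv => Or.inl ⟨hv, rfl⟩
    · intro a ha b hb h
      rcases Sym2.eq_iff.1 h with ⟨h, -⟩ | ⟨h, -⟩
      exacts [h, absurd (h ▸ ha) (hc b hb)]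

end SimpleGraph

/-- Every tree with `n ≥ 2` vertices and exactly `L` leaves contains a
matching of size at least `(n − L)/2`. -/
theorem tree_matching_of_leaves
    {V : Type*} [Fintype V] (T : SimpleGraph V) (hT : T.IsTree)
    (hn : 2 ≤ Fintype.card V)
    (L : ℕ) (hL : L = {v : V | (T.neighborSet v).ncard = 1}.ncard) :
    ∃ M : T.Subgraph, M.IsMatching ∧
      ((Fintype.card V : ℝ) - (L : ℝ)) / 2 ≤ (M.edgeSet.ncard : ℝ) := by
  have : Nontrivial V := Fintype.one_lt_card_iff_nontrivial.1 hn
  obtain ⟨r⟩ := hT.connected.nonempty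
  set leaves : Set V := {v | (T.neighborSet v).ncard = 1}
  have child : ∀ v, ∃ w, v ∈ leavesᶜ → T.Adj v w ∧ T.dist r w = T.dist r v + 1 := by
    intro v
    by_cases hv : v ∈ leavesᶜ
    · obtain ⟨w, hw⟩ := hT.exists_adj_dist_eq_add_one r hv
      exact ⟨w, fun _ => hw⟩
    · exact ⟨v, fun h => absurd h hv⟩
  choose c hc using child
  have matching : ∀ s ⊆ leavesᶜ, (∀ u ∈ s, ∀ v ∈ s, (Even (T.dist r u) ↔ Even (T.dist r v))) →
      ∃ M : T.Subgraph, M.IsMatching ∧ s.ncard ≤ M.edgeSet.ncard := by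
    intro s hs parity
    refine SimpleGraph.exists_isMatching_ncard_le s c (fun v hv => (hc v (hs hv)).1) ?_ ?_
    · intro v hv hcv
      have := parity v hv _ hcv
      rw [(hc v (hs hv)).2, Nat.even_add_one] at this
      tauto
    · intro a ha b hb hab
      obtain ⟨adj_a, dist_a⟩ := hc a (hs ha)
      obtain ⟨adj_b, dist_b⟩ := hc b (hs hb)
      rw [← hab] at adj_b dist_b
      exact hT.eq_of_adj_of_dist_add_one adj_a adj_b dist_a.symm dist_b.symm
  set E : Set V := {v | Even (T.dist r v)}
  obtain ⟨M₁, hM₁, h₁⟩ := matching (leavesᶜ ∩ E) Set.inter_subset_left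
    fun u hu v hv => iff_of_true hu.2 hv.2
  obtain ⟨M₂, hM₂, h₂⟩ := matching (leavesᶜ \ E) Set.sdiff_subset
    fun u hu v hv => iff_of_false hu.2 hv.2
  have split := Set.ncard_inter_add_ncard_sdiff_eq_ncard leavesᶜ E
  have total := Set.ncard_add_ncard_compl leaves
  rw [Nat.card_eq_fintype_card, ← hL] at total
  have bound : Fintype.card V ≤ L + M₁.edgeSet.ncard + M₂.edgeSet.ncard := by omega
  have bound' : (Fintype.card V : ℝ) ≤ L + M₁.edgeSet.ncard + M₂.edgeSet.ncard := by
    exact_mod_cast bound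
  rcases le_total (M₁.edgeSet.ncard : ℝ) M₂.edgeSet.ncard with h | h
  · exact ⟨M₂, hM₂, by linarith⟩
  · exact ⟨M₁, hM₁, by linarith⟩
end

section
/- For every tree T with at least 2 vertices, the number of maximal induced subpaths of T is at most twice the number of leaves of T. -/
open scoped Classical

variable {V : Type*}

/-- `S` is the edge set of an induced subpath of the tree `T`: a path in `T` all of whose
internal vertices have degree `2` in `T`. (A path in a tree is determined by its edge
set.) -/
def IsInducedSubpath (T : SimpleGraph V) (S : Set (Sym2 V)) : Prop :=
  ∃ (u v : V) (p : T.Walk u v), p.IsPath ∧ S = {e | e ∈ p.edges} ∧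
    ∀ x ∈ p.support, x ≠ u → x ≠ v → (T.neighborSet x).ncard = 2

/-- A maximal induced subpath: an induced subpath that is not a proper subpath of any
other induced subpath. -/
def IsMaximalInducedSubpath (T : SimpleGraph V) (S : Set (Sym2 V)) : Prop :=
  IsInducedSubpath T S ∧ ∀ S', IsInducedSubpath T S' → S ⊆ S' → S' = S

/-- `S` is the edge set of a path starting with the edge from `x` to `y`, whose internal vertices
have degree `2` and whose final vertex does not. -/
def IsSubpathFrom (T : SimpleGraph V) (S : Set (Sym2 V)) (x y : V) : Prop :=
  ∃ (v : V) (h : T.Adj x y) (p : T.Walk y v), (p.cons h).IsPath ∧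
    S = {e | e ∈ (p.cons h).edges} ∧ (T.neighborSet v).ncard ≠ 2 ∧
    ∀ z ∈ p.support, z ≠ v → (T.neighborSet z).ncard = 2

theorem eq_of_neighborSet_ncard_eq_two {T : SimpleGraph V} {x a y z : V}
    (hx : (T.neighborSet x).ncard = 2) (ha : T.Adj x a) (hy : T.Adj x y) (hz : T.Adj x z)
    (hya : y ≠ a) (hza : z ≠ a) : y = z := by
  obtain ⟨b, c, -, hbc⟩ := Set.ncard_eq_two.mp hx
  have key : ∀ w, T.Adj x w → w = b ∨ w = c := fun w hw => by
    have : w ∈ T.neighborSet x := hw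
    simpa [hbc] using this
  grind

/-- Paths leaving `x` away from `a`, through vertices of degree `2` up to the first vertex of
another degree, have the same edges. -/
theorem edges_eq_of_forced {T : SimpleGraph V} {v w : V}
    (hv : (T.neighborSet v).ncard ≠ 2) (hw : (T.neighborSet w).ncard ≠ 2) :
    ∀ {x a : V} (_ : T.Adj x a) (p : T.Walk x v) (q : T.Walk x w), p.IsPath → q.IsPath →
      a ∉ p.support → a ∉ q.support →
      (∀ z ∈ p.support, z ≠ v → (T.neighborSet z).ncard = 2) →
      (∀ z ∈ q.support, z ≠ w → (T.neighborSet z).ncard = 2) → p.edges = q.edges := by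
  intro x a ha p
  induction p generalizing a with
  | nil =>
    intro q _ hq _ _ _ hq2
    cases q with
    | nil => rfl
    | cons h q =>
      exact absurd (hq2 _ (by simp) fun e => by
        subst e; exact ((SimpleGraph.Walk.cons_isPath_iff _ _).mp hq).2 (by simp)) hv
  | @cons x y v h p ih =>
    intro q hp hq hap haq hp2 hq2
    have hp' := (SimpleGraph.Walk.cons_isPath_iff _ _).mp hp
    have hxv : x ≠ v := fun e => hp'.2 (e ▸ p.end_mem_support)
    have hx : (T.neighborSet x).ncard = 2 := hp2 _ (by simp) hxv
    cases q with
    | nil => exact absurd hx hw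
    | @cons _ z _ h' q =>
      have hq' := (SimpleGraph.Walk.cons_isPath_iff _ _).mp hq
      simp only [SimpleGraph.Walk.support_cons, List.mem_cons, not_or] at hap haq
      obtain rfl : y = z := eq_of_neighborSet_ncard_eq_two hx ha h h'
        (fun e => hap.2 (e ▸ p.start_mem_support)) (fun e => haq.2 (e ▸ q.start_mem_support))
      rw [SimpleGraph.Walk.edges_cons, SimpleGraph.Walk.edges_cons,
        ih hv h.symm q hp'.1 hq'.1 hp'.2 hq'.2 (fun z hz => hp2 z (by simp [hz]))
          (fun z hz => hq2 z (by simp [hz]))]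

theorem IsSubpathFrom.unique {T : SimpleGraph V} {S S' : Set (Sym2 V)} {x y : V}
    (hS : IsSubpathFrom T S x y) (hS' : IsSubpathFrom T S' x y) : S = S' := by
  obtain ⟨v, h, p, hp, rfl, hv, hp2⟩ := hS
  obtain ⟨w, h', q, hq, rfl, hw, hq2⟩ := hS'
  rw [SimpleGraph.Walk.cons_isPath_iff] at hp hq
  rw [SimpleGraph.Walk.edges_cons, SimpleGraph.Walk.edges_cons,
    edges_eq_of_forced hv hw h.symm p q hp.1 hq.1 hp.2 hq.2 hp2 hq2]

/-- In an acyclic graph, a neighbour of the start of a path that lies on the path is its second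
vertex. -/
theorem eq_second_of_adj_of_mem_support {T : SimpleGraph V} (hT : T.IsAcyclic) {u x v y : V}
    (h : T.Adj u x) (p : T.Walk x v) (hp : (p.cons h).IsPath) (hy : T.Adj u y)
    (hyp : y ∈ p.support) : y = x := by
  rw [SimpleGraph.Walk.cons_isPath_iff] at hp
  have hq : ((p.takeUntil y hyp).cons h).IsPath :=
    (SimpleGraph.Walk.cons_isPath_iff _ _).mpr
      ⟨hp.1.takeUntil hyp, fun hu => hp.2 (p.support_takeUntil_subset_support hyp hu)⟩
  have key := congrArg (fun P : T.Path u y => P.1.length)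
    ((hT.subsingleton_path u y).elim ⟨_, hq⟩ (SimpleGraph.Path.singleton hy))
  simp only [SimpleGraph.Walk.length_cons, SimpleGraph.Path.singleton,
    SimpleGraph.Walk.length_nil, Nat.add_eq_right] at key
  exact (SimpleGraph.Walk.eq_of_length_eq_zero key).symm

/-- The endpoints of a maximal induced subpath do not have degree `2`. -/
theorem IsMaximalInducedSubpath.start_ncard_ne_two {T : SimpleGraph V} (hT : T.IsAcyclic)
    {u v : V} (p : T.Walk u v) (huv : u ≠ v) (hp : p.IsPath)
    (hp2 : ∀ z ∈ p.support, z ≠ u → z ≠ v → (T.neighborSet z).ncard = 2)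
    (hS : IsMaximalInducedSubpath T {e | e ∈ p.edges}) : (T.neighborSet u).ncard ≠ 2 := by
  cases p with
  | nil => exact absurd rfl huv
  | @cons _ x _ h p =>
    intro hu
    obtain ⟨y, hy, hyx⟩ := Set.exists_ne_of_one_lt_ncard (by omega : 1 < (T.neighborSet u).ncard) x
    have hyu : T.Adj y u := (show T.Adj u y from hy).symm
    have hyp : y ∉ (p.cons h).support := by
      rw [SimpleGraph.Walk.support_cons, List.mem_cons, not_or]
      exact ⟨hyu.ne, fun hm => hyx (eq_second_of_adj_of_mem_support hT h p hp hy hm)⟩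
    have heq := hS.2 {e | e ∈ ((p.cons h).cons hyu).edges}
      ⟨y, v, (p.cons h).cons hyu, (SimpleGraph.Walk.cons_isPath_iff _ _).mpr ⟨hp, hyp⟩, rfl, by
        intro z hz hzy hzv
        rw [SimpleGraph.Walk.support_cons, List.mem_cons] at hz
        by_cases hzu : z = u
        · rwa [hzu]
        · exact hp2 z (hz.resolve_left hzy) hzu hzv⟩
      (fun e he => by
        rw [Set.mem_ofPred_eq, SimpleGraph.Walk.edges_cons]; exact List.mem_cons_of_mem _ he)
    have hmem : s(y, u) ∈ {e | e ∈ (p.cons h).edges} := by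
      rw [← heq]; simp
    exact hyp ((p.cons h).fst_mem_support_of_mem_edges hmem)

/-- A maximal induced subpath, traversed from its start, is a subpath in the sense of
`IsSubpathFrom`. -/
theorem IsMaximalInducedSubpath.isSubpathFrom {T : SimpleGraph V} (hT : T.IsAcyclic) {u v : V}
    (p : T.Walk u v) (huv : u ≠ v) (hp : p.IsPath)
    (hp2 : ∀ z ∈ p.support, z ≠ u → z ≠ v → (T.neighborSet z).ncard = 2)
    (hS : IsMaximalInducedSubpath T {e | e ∈ p.edges}) (hv : (T.neighborSet v).ncard ≠ 2) :
    ∃ x, T.Adj u x ∧ (T.neighborSet u).ncard ≠ 2 ∧ IsSubpathFrom T {e | e ∈ p.edges} u x := by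
  cases p with
  | nil => exact absurd rfl huv
  | @cons _ x _ h p =>
    refine ⟨x, h, hS.start_ncard_ne_two hT (p.cons h) huv hp hp2, v, h, p, hp, rfl, hv, fun z hz hzv => ?_⟩
    refine hp2 z (by simp [hz]) (fun e => ?_) hzv
    exact ((SimpleGraph.Walk.cons_isPath_iff _ _).mp hp).2 (e ▸ hz)

/-- A maximal induced subpath of a nontrivial tree can be traversed from two distinct vertices. -/
theorem IsMaximalInducedSubpath.exists_two_starts [Nontrivial V] {T : SimpleGraph V}
    (hT : T.IsTree) {S : Set (Sym2 V)} (hS : IsMaximalInducedSubpath T S) :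
    ∃ u v, u ≠ v ∧
      (∃ x, T.Adj u x ∧ (T.neighborSet u).ncard ≠ 2 ∧ IsSubpathFrom T S u x) ∧
      ∃ y, T.Adj v y ∧ (T.neighborSet v).ncard ≠ 2 ∧ IsSubpathFrom T S v y := by
  obtain ⟨u, v, p, hp, rfl, hp2⟩ := hS.1
  have huv : u ≠ v := by
    rintro rfl
    obtain rfl := (SimpleGraph.Walk.isPath_iff_nil.mp hp).eq_nil
    obtain ⟨w, hw⟩ := hT.connected.preconnected.exists_adj_of_nontrivial u
    have heq := hS.2 {e | e ∈ hw.toWalk.edges}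
      ⟨u, w, hw.toWalk, (SimpleGraph.Path.singleton hw).2, rfl, by
        intro z hz h1 h2; simp at hz; tauto⟩ (by simp)
    have : s(u, w) ∈ {e | e ∈ (SimpleGraph.Walk.nil : T.Walk u u).edges} := by
      rw [← heq]; simp
    simp at this
  have hr : {e | e ∈ p.reverse.edges} = {e | e ∈ p.edges} := by simp
  have hr2 : ∀ z ∈ p.reverse.support, z ≠ v → z ≠ u → (T.neighborSet z).ncard = 2 :=
    fun z hz h1 h2 => hp2 z (by simpa using hz) h2 h1
  have hSr : IsMaximalInducedSubpath T {e | e ∈ p.reverse.edges} := hr ▸ hS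
  refine ⟨u, v, huv, hS.isSubpathFrom hT.isAcyclic p huv hp hp2 ?_, ?_⟩
  · exact hSr.start_ncard_ne_two hT.isAcyclic p.reverse huv.symm hp.reverse hr2
  · rw [← hr]
    exact hSr.isSubpathFrom hT.isAcyclic p.reverse huv.symm hp.reverse hr2
      (hS.start_ncard_ne_two hT.isAcyclic p huv hp hp2)

theorem neighborSet_ncard_eq_degree [Fintype V] (T : SimpleGraph V) (x : V) :
    (T.neighborSet x).ncard = T.degree x := by
  rw [Set.ncard_eq_toFinset_card']; rfl

/-- In a nontrivial tree, the degrees different from `2` sum to at most four times the number of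
leaves. -/
theorem sum_degree_ne_two_le [Fintype V] [Nontrivial V] {T : SimpleGraph V} (hT : T.IsTree) :
    ∑ x with T.degree x ≠ 2, T.degree x ≤ 4 * (Finset.univ.filter (T.degree · = 1)).card := by
  have hsum := T.sum_degrees_eq_twice_card_edges
  have hcard := hT.card_edgeFinset
  have hpos : ∀ x, 0 < T.degree x := fun x => hT.connected.preconnected.degree_pos_of_nontrivial x
  have key : ∑ x, ((if T.degree x ≠ 2 then T.degree x else 0) + 6) ≤
      ∑ x, (3 * T.degree x + 4 * if T.degree x = 1 then 1 else 0) := by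
    refine Finset.sum_le_sum fun x _ => ?_
    have := hpos x
    split_ifs <;> omega
  rw [Finset.sum_add_distrib, Finset.sum_add_distrib, ← Finset.mul_sum, ← Finset.mul_sum, hsum,
    ← Finset.sum_filter, ← Finset.card_filter, Finset.sum_const, Finset.card_univ,
    smul_eq_mul] at key
  omega

/-- For every tree `T` with at least `2` vertices, the number of maximal
induced subpaths of `T` is at most twice the number of leaves of `T`. -/
theorem maximal_induced_subpaths_le_two_mul_leaves
    {V : Type*} [Fintype V] (T : SimpleGraph V) (hT : T.IsTree)
    (hn : 2 ≤ Fintype.card V) :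
    {S : Set (Sym2 V) | IsMaximalInducedSubpath T S}.ncard ≤
      2 * {v : V | (T.neighborSet v).ncard = 1}.ncard := by
  have : Nontrivial V := Fintype.one_lt_card_iff_nontrivial.mp hn
  set M := {S : Set (Sym2 V) | IsMaximalInducedSubpath T S}.toFinset with hM
  set D : Finset (Σ _ : V, V) :=
    (Finset.univ.filter (T.degree · ≠ 2)).sigma fun x => T.neighborFinset x with hD
  have hmem : ∀ {S : Set (Sym2 V)} {u x : V}, T.Adj u x → (T.neighborSet u).ncard ≠ 2 →
      IsSubpathFrom T S u x →
      ⟨u, x⟩ ∈ D.bipartiteAbove (fun S d => IsSubpathFrom T S d.1 d.2) S := by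
    intro S u x h hu hS
    rw [neighborSet_ncard_eq_degree] at hu
    simp [Finset.mem_bipartiteAbove, hD, h, hu, hS]
  have hcount : M.card * 2 ≤ D.card * 1 := by
    refine Finset.card_mul_le_card_mul (fun S d => IsSubpathFrom T S d.1 d.2) (fun S hS => ?_)
      (fun d _ => Finset.card_le_one.mpr fun S hS S' hS' => ?_)
    · rw [hM, Set.mem_toFinset] at hS
      obtain ⟨u, v, huv, ⟨x, hx, hu, hSu⟩, y, hy, hv, hSv⟩ := hS.exists_two_starts hT
      refine Finset.one_lt_card.mpr ⟨⟨u, x⟩, hmem hx hu hSu, ⟨v, y⟩, hmem hy hv hSv, fun e => ?_⟩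
      exact huv (congrArg Sigma.fst e)
    · rw [Finset.mem_bipartiteBelow] at hS hS'
      exact hS.2.unique hS'.2
  have hDcard : D.card = ∑ x with T.degree x ≠ 2, T.degree x := by
    simp [hD, Finset.card_sigma]
  have hle := sum_degree_ne_two_le hT
  have hleaf : {v : V | (T.neighborSet v).ncard = 1}.ncard =
      (Finset.univ.filter (T.degree · = 1)).card := by
    rw [Set.ncard_eq_toFinset_card']
    congr 1
    ext v
    simp [neighborSet_ncard_eq_degree]
  rw [hleaf, Set.ncard_eq_toFinset_card', ← hM]
  omega
end

section
/- Let T be a tree, let V_1 be the set of vertices of T having odd degree in T, and let M be a perfect matching on V_1, i.e., a partition of V_1 into unordered pairs. Then every edge of T is covered by some pair of M, i.e., for every edge f of T there is a pair (u,v) ∈ M such that f lies on the unique path in T between u and v. -/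
open scoped Classical

variable {V : Type*}

/-- `M` is a perfect matching on the vertex set `S`: a partition of `S` into unordered
pairs (of distinct vertices). -/
def IsPerfectMatchingOn (S : Set V) (M : Set (Sym2 V)) : Prop :=
  (∀ e ∈ M, ¬ e.IsDiag) ∧ (∀ e ∈ M, ∀ x ∈ e, x ∈ S) ∧
    (∀ x ∈ S, ∃! e, e ∈ M ∧ x ∈ e)

/-- If exactly one edge of `G` leaves the finite vertex set `S`, then the degrees of the vertices
of `S` have an odd sum. -/
theorem SimpleGraph.odd_sum_ncard_neighborSet {V : Type*} [Fintype V] (G : SimpleGraph V)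
    (S : Finset V) {a b : V} (ha : a ∈ S) (hb : b ∉ S) (hab : G.Adj a b)
    (hcut : ∀ x ∈ S, ∀ y ∉ S, G.Adj x y → x = a ∧ y = b) :
    Odd (∑ v ∈ S, (G.neighborSet v).ncard) := by
  have hcard : ∑ v ∈ S, (G.neighborSet v).ncard =
      ((S ×ˢ Finset.univ).filter fun p : V × V => G.Adj p.1 p.2).card := by
    rw [Finset.card_filter, Finset.sum_product]
    refine Finset.sum_congr rfl fun v _ => ?_
    rw [← Finset.card_filter, Set.ncard_eq_toFinset_card']
    congr 1
    ext w
    simp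
  have hmem : (a, b) ∈ (S ×ˢ Finset.univ).filter fun p : V × V => G.Adj p.1 p.2 := by
    simp [ha, hab]
  rw [hcard, ← Finset.card_erase_add_one hmem]
  refine Even.add_one ?_
  rw [← ZMod.natCast_eq_zero_iff_even, Finset.cast_card]
  refine Finset.sum_involution (fun p _ => p.swap) ?_ ?_ ?_ ?_
  · intros
    decide
  · rintro ⟨x, y⟩ hp _ h
    have hxy : G.Adj x y := (Finset.mem_filter.mp (Finset.mem_of_mem_erase hp)).2
    simp only [Prod.swap_prod_mk, Prod.mk.injEq] at h
    exact hxy.ne h.2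
  · rintro ⟨x, y⟩ hp
    simp only [Finset.mem_erase, Finset.mem_filter, Finset.mem_product, Finset.mem_univ,
      and_true, Prod.swap_prod_mk, ne_eq, Prod.mk.injEq] at hp ⊢
    obtain ⟨hne, hx, hxy⟩ := hp
    have hy : y ∈ S := by
      by_contra hy
      exact hne (hcut x hx y hy hxy)
    exact ⟨fun h => hb (h.2 ▸ hx), hy, hxy.symm⟩
  · simp

/-- A finite set of matched vertices that is a union of pairs of the matching has even size. -/
theorem IsPerfectMatchingOn.even_card {V : Type*} {S : Set V} {M : Set (Sym2 V)}
    (hM : IsPerfectMatchingOn S M) (A : Finset V) (hAS : ∀ x ∈ A, x ∈ S)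
    (hA : ∀ x y, s(x, y) ∈ M → x ∈ A → y ∈ A) : Even A.card := by
  obtain ⟨hdiag, -, huniq⟩ := hM
  have hpartner : ∀ x, ∃ y, x ∈ A → s(x, y) ∈ M := by
    intro x
    by_cases hx : x ∈ A
    · obtain ⟨e, ⟨he, y, rfl⟩, -⟩ := huniq x (hAS x hx)
      exact ⟨y, fun _ => he⟩
    · exact ⟨x, fun h => absurd h hx⟩
  choose g hg using hpartner
  rw [← ZMod.natCast_eq_zero_iff_even, Finset.cast_card]
  refine Finset.sum_involution (fun x _ => g x) ?_ ?_ ?_ ?_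
  · intros
    decide
  · intro x hx _ h
    have hxM := hg x hx
    rw [h] at hxM
    exact hdiag _ hxM rfl
  · exact fun x hx => hA x _ (hg x hx) hx
  · intro x hx
    have hgx := hA x _ (hg x hx) hx
    have h := (huniq (g x) (hAS _ hgx)).unique ⟨hg _ hgx, Sym2.mem_mk_left _ _⟩
      ⟨hg x hx, Sym2.mem_mk_right _ _⟩
    rw [Sym2.eq_swap] at h
    exact Sym2.congr_left.mp h

/-- Let `T` be a tree, `V₁` its set of odd-degree vertices and `M` a
perfect matching on `V₁`. Then every edge of `T` is covered by some pair of `M`. -/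
theorem every_edge_covered_by_odd_vertex_matching
    {V : Type*} [Fintype V] (T : SimpleGraph V) (hT : T.IsTree)
    (M : Set (Sym2 V))
    (hM : IsPerfectMatchingOn {v : V | Odd ((T.neighborSet v).ncard)} M) :
    ∀ f ∈ T.edgeSet, ∃ e ∈ M, covers T e f := by
  intro f hf
  induction f using Sym2.ind with
  | _ a b =>
  have hbridge : ¬ (T.deleteEdges {s(a, b)}).Reachable a b :=
    SimpleGraph.isBridge_iff.mp (SimpleGraph.isAcyclic_iff_forall_isBridge.mp hT.isAcyclic hf)
  set S : Finset V := Finset.univ.filter fun x => (T.deleteEdges {s(a, b)}).Reachable a x with hS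
  have ha : a ∈ S := by simp [hS]
  have hb : b ∉ S := by simpa [hS] using hbridge
  have hodd := T.odd_sum_ncard_neighborSet S ha hb hf fun x hx y hy hxy => by
    have hxy' : s(x, y) = s(a, b) := by
      by_contra hne
      have hadj : (T.deleteEdges {s(a, b)}).Adj x y := by
        simpa [SimpleGraph.deleteEdges_adj, hxy] using hne
      simp only [hS, Finset.mem_filter, Finset.mem_univ, true_and] at hx hy
      exact hy (hx.trans hadj.reachable)
    rcases Sym2.eq_iff.mp hxy' with h | h
    · exact h
    · exact absurd (h.1 ▸ hx) hb
  rw [Finset.odd_sum_iff_odd_card_odd] at hodd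
  by_contra! hcov
  refine Nat.not_even_iff_odd.mpr hodd (hM.even_card _ (fun x hx => (Finset.mem_filter.mp hx).2) ?_)
  intro x y hxy hx
  rw [Finset.mem_filter] at hx ⊢
  refine ⟨?_, hM.2.1 _ hxy y (Sym2.mem_mk_right _ _)⟩
  obtain ⟨p, hp, -⟩ := hT.existsUnique_path x y
  have hfp : s(a, b) ∉ p.edges := fun h => hcov _ hxy ⟨x, y, p, rfl, hp, h⟩
  have hx' := hx.1
  simp only [hS, Finset.mem_filter, Finset.mem_univ, true_and] at hx' ⊢
  exact hx'.trans (p.toDeleteEdge _ hfp).reachable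
end

section
/- Let H be a finite connected multigraph with vertex set V, whose edges are pairs of distinct points of V (possibly with multiplicity), such that every vertex of H has even degree. Let B be the set of edges of the underlying simple graph of H that are bridges of that simple graph. Then the total weight of H, counting multiplicities, is at least MST(w) + ∑_{b ∈ B} w(b). -/
open scoped Classical

variable {V : Type*}

theorem setWeight_eq_sum_map [Fintype V] (w : V → V → ℝ) (S : Set (Sym2 V)) :
    setWeight w S = (S.toFinite.toFinset.val.map (sym2Weight w)).sum :=
  finsum_mem_eq_finite_toFinset_sum _ _

theorem MSTcost_le [Fintype V] {w : V → V → ℝ} (hw : IsMetric w) {T : SimpleGraph V}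
    (hT : T.IsTree) : MSTcost V w ≤ setWeight w T.edgeSet := by
  refine csInf_le ⟨0, ?_⟩ ⟨T, hT, rfl⟩
  rintro x ⟨T', -, rfl⟩
  rw [setWeight_eq_sum_map]
  exact Finset.sum_nonneg fun e _ => sym2Weight_nonneg hw e

/-- Double counting of the incidences between a vertex set and a multiset of edges. -/
theorem sum_card_filter_mem_eq_sum_map (S : Finset V) (E : Multiset (Sym2 V)) :
    ∑ v ∈ S, Multiset.card (E.filter (fun e => v ∈ e)) =
      (E.map (fun e => (S.filter (fun v => v ∈ e)).card)).sum := by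
  induction E using Multiset.induction_on with
  | empty => simp
  | cons a E ih =>
    rw [Multiset.map_cons, Multiset.sum_cons, ← ih, Finset.card_filter, ← Finset.sum_add_distrib]
    refine Finset.sum_congr rfl fun v _ => ?_
    by_cases h : v ∈ a
    · simp [h, add_comm]
    · simp [h]

/-- A bridge of the underlying simple graph of a multigraph with even degrees has even
multiplicity. -/
theorem even_count_of_isBridge [Fintype V] {E : Multiset (Sym2 V)}
    (hnotDiag : ∀ e ∈ E, ¬ Sym2.IsDiag e)
    (heven : ∀ v : V, Even (Multiset.card (E.filter (fun e => v ∈ e)))) {b : Sym2 V}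
    (hb : (SimpleGraph.fromEdgeSet {e | e ∈ E}).IsBridge b) : Even (E.count b) := by
  induction b with
  | h u v =>
  rw [SimpleGraph.isBridge_iff] at hb
  set G := (SimpleGraph.fromEdgeSet {e | e ∈ E}).deleteEdges {s(u, v)} with hG
  let S : Finset V := Finset.univ.filter fun x => G.Reachable u x
  have hpar : ∀ f ∈ E, (((S.filter (fun x => x ∈ f)).card : ℕ) : ZMod 2) =
      if s(u, v) = f then 1 else 0 := by
    intro f hf
    have hd := hnotDiag f hf
    induction f with
    | h x y =>
    rw [Sym2.mk_isDiag_iff] at hd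
    split_ifs with huv
    · have : S.filter (fun z => z ∈ s(x, y)) = {u} := by
        ext z
        rw [← huv]
        simp only [S, Finset.mem_filter, Finset.mem_univ, true_and, Sym2.mem_iff,
          Finset.mem_singleton]
        constructor
        · rintro ⟨hz, rfl | rfl⟩
          · rfl
          · exact absurd hz hb
        · rintro rfl
          exact ⟨SimpleGraph.Reachable.refl _, Or.inl rfl⟩
      rw [this, Finset.card_singleton, Nat.cast_one]
    · have hadj : G.Adj x y := by
        rw [hG, SimpleGraph.deleteEdges_adj, SimpleGraph.fromEdgeSet_adj]
        exact ⟨⟨hf, hd⟩, fun h => huv (Set.mem_singleton_iff.mp h).symm⟩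
      have hiff : G.Reachable u x ↔ G.Reachable u y :=
        ⟨fun h => h.trans hadj.reachable, fun h => h.trans hadj.symm.reachable⟩
      by_cases hx : G.Reachable u x
      · have : S.filter (fun z => z ∈ s(x, y)) = {x, y} := by
          ext z
          simp only [S, Finset.mem_filter, Finset.mem_univ, true_and, Sym2.mem_iff,
            Finset.mem_insert, Finset.mem_singleton, and_iff_right_iff_imp]
          rintro (rfl | rfl)
          · exact hx
          · exact hiff.mp hx
        rw [this, Finset.card_pair hd]
        rfl
      · have : S.filter (fun z => z ∈ s(x, y)) = ∅ := by
          ext z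
          simp only [S, Finset.mem_filter, Finset.mem_univ, true_and, Sym2.mem_iff,
            Finset.notMem_empty, iff_false, not_and]
          rintro hz (rfl | rfl)
          · exact hx hz
          · exact hx (hiff.mpr hz)
        rw [this, Finset.card_empty, Nat.cast_zero]
  have hsum := congrArg (Nat.cast : ℕ → ZMod 2) (sum_card_filter_mem_eq_sum_map S E)
  rw [Nat.cast_sum, Finset.sum_eq_zero fun x _ => (ZMod.natCast_eq_zero_iff_even).mpr (heven x),
    Nat.cast_multiset_sum, Multiset.map_map] at hsum
  replace hsum := hsum.trans (congrArg Multiset.sum (Multiset.map_congr rfl hpar))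
  rw [← ZMod.natCast_eq_zero_iff_even, hsum]
  clear * -
  induction E using Multiset.induction_on with
  | empty => simp
  | cons a E ih => simp [Multiset.count_cons, ih, add_comm]

/-- Let `H` be a finite connected multigraph with vertex set `V` (edge
multiset `E`, all edges joining distinct points) in which every vertex has even degree,
and let `B` be the set of bridges of the underlying simple graph of `H`. Then the total
weight of `H`, counting multiplicities, is at least `MST(w) + ∑_{b ∈ B} w(b)`. -/
theorem eulerian_multigraph_weight_ge_mst_add_bridges
    {V : Type*} [Fintype V] (hn : 2 ≤ Fintype.card V)
    (w : V → V → ℝ) (hw : IsMetric w)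
    (E : Multiset (Sym2 V))
    (hnotDiag : ∀ e ∈ E, ¬ Sym2.IsDiag e)
    (hconn : (SimpleGraph.fromEdgeSet {e | e ∈ E}).Connected)
    (heven : ∀ v : V, Even (Multiset.card (E.filter (fun e => v ∈ e)))) :
    MSTcost V w +
        setWeight w {e | (SimpleGraph.fromEdgeSet {e' | e' ∈ E}).IsBridge e}
      ≤ (E.map (sym2Weight w)).sum := by
  set G := SimpleGraph.fromEdgeSet {e | e ∈ E} with hG
  obtain ⟨T, hTG, hT⟩ := hconn.exists_isTree_le
  have hTE : ∀ e ∈ T.edgeSet, e ∈ E := fun e he => by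
    have := SimpleGraph.edgeSet_mono hTG he
    rw [hG, SimpleGraph.edgeSet_fromEdgeSet] at this
    exact this.1
  have hBT : ∀ e, G.IsBridge e → e ∈ T.edgeSet := fun e he => by
    induction e with
    | h x y =>
    exact (he.anti hTG).reachable_iff_adj.mp (hT.connected x y)
  have hle : T.edgeSet.toFinite.toFinset.val +
      (Set.toFinite {e | G.IsBridge e}).toFinset.val ≤ E := by
    rw [Multiset.le_iff_count]
    intro e
    rw [Multiset.count_add, Multiset.count_eq_of_nodup (Finset.nodup _),
      Multiset.count_eq_of_nodup (Finset.nodup _)]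
    simp only [Finset.mem_val, Set.Finite.mem_toFinset, Set.mem_ofPred_eq]
    by_cases heT : e ∈ T.edgeSet
    · have hpos : 0 < E.count e := Multiset.count_pos.mpr (hTE e heT)
      by_cases heB : G.IsBridge e
      · obtain ⟨k, hk⟩ := even_count_of_isBridge hnotDiag heven heB
        rw [if_pos heT, if_pos heB]
        omega
      · rw [if_pos heT, if_neg heB]
        omega
    · rw [if_neg heT, if_neg fun h => heT (hBT e h)]
      exact Nat.zero_le _
  obtain ⟨R, hR⟩ := Multiset.le_iff_exists_add.mp hle
  have hRnonneg : 0 ≤ (R.map (sym2Weight w)).sum := Multiset.sum_nonneg fun x hx => by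
    obtain ⟨e, -, rfl⟩ := Multiset.mem_map.mp hx
    exact sym2Weight_nonneg hw e
  have hmst := MSTcost_le hw hT
  rw [setWeight_eq_sum_map] at hmst ⊢
  rw [hR, Multiset.map_add, Multiset.map_add, Multiset.sum_add, Multiset.sum_add]
  linarith
end
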